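/- arXiv:1907.05044 — 3 statements merged into one kernel-verified Lean document; each statement's English description precedes it below -/
import Mathlib

section
/- Let φ : ℝ → ℝ be twice continuously differentiable with φ integrable on ℝ and with finite sup norms ‖φ‖_∞ and ‖φ''‖_∞. Then there is a constant C, depending only on ‖φ‖_{L¹}, ‖φ‖_∞ and ‖φ''‖_∞, such that for every ν ∈ (0,1/2], | ∫_ℝ (ν/(t²+ν²)) φ(t) dt − π φ(0) | ≤ C ν. -/
open MeasureTheory

/-- The second symmetric difference of a function with bounded second derivative is at most
quadratic. -/
theorem abs_symm_second_diff_le {φ : ℝ → ℝ} {A : ℝ} (hφ : ContDiff ℝ 2 φ)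
    (hA : ∀ t, |deriv (deriv φ) t| ≤ A) (t : ℝ) :
    |φ t + φ (-t) - 2 * φ 0| ≤ 2 * A * t ^ 2 := by
  have hA0 : 0 ≤ A := (abs_nonneg _).trans (hA 0)
  have hd : Differentiable ℝ φ := hφ.differentiable (by norm_num)
  have hd' : Differentiable ℝ (deriv φ) :=
    ((contDiff_succ_iff_deriv (n := 1)).1 hφ).2.2.differentiable (by norm_num)
  have hlip : ∀ x y, |deriv φ y - deriv φ x| ≤ A * |y - x| := fun x y =>
    convex_univ.norm_image_sub_le_of_norm_deriv_le (fun z _ => hd' z) (fun z _ => hA z)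
      (Set.mem_univ x) (Set.mem_univ y)
  have hderiv : ∀ x, HasDerivAt (fun s => φ s + φ (-s)) (deriv φ x - deriv φ (-x)) x := by
    intro x
    have h := (hd x).hasDerivAt.add ((hd (-x)).hasDerivAt.comp x (hasDerivAt_neg x))
    exact h.congr_deriv (by ring)
  have hbound : ∀ x ∈ Set.Icc (-|t|) |t|, ‖deriv φ x - deriv φ (-x)‖ ≤ 2 * A * |t| := by
    intro x hx
    have h := hlip (-x) x
    have hx' : |x| ≤ |t| := abs_le.2 hx
    have h2 : |x - -x| = 2 * |x| := by
      rw [sub_neg_eq_add, ← two_mul, abs_mul, abs_two]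
    rw [h2] at h
    rw [Real.norm_eq_abs]
    nlinarith
  have h := (convex_Icc (-|t|) |t|).norm_image_sub_le_of_norm_hasDerivWithin_le
    (fun x _ => (hderiv x).hasDerivWithinAt) hbound
    (x := 0) (y := t) (by simp) ⟨neg_abs_le t, le_abs_self t⟩
  simp only [Real.norm_eq_abs, neg_zero, sub_zero] at h
  rw [mul_assoc, abs_mul_abs_self] at h
  rwa [two_mul (φ 0), pow_two]

theorem poisson_kernel_eq {ν : ℝ} (hν : 0 < ν) (t : ℝ) :
    ν / (t ^ 2 + ν ^ 2) = ν⁻¹ * (1 + (t / ν) ^ 2)⁻¹ := by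
  field_simp
  ring

theorem integrable_poisson_kernel {ν : ℝ} (hν : 0 < ν) :
    Integrable fun t : ℝ => ν / (t ^ 2 + ν ^ 2) := by
  simp_rw [poisson_kernel_eq hν]
  exact (integrable_inv_one_add_sq.comp_div hν.ne').const_mul _

theorem integral_poisson_kernel {ν : ℝ} (hν : 0 < ν) :
    ∫ t : ℝ, ν / (t ^ 2 + ν ^ 2) = Real.pi := by
  simp_rw [poisson_kernel_eq hν]
  rw [integral_const_mul, Measure.integral_comp_div (fun x : ℝ => (1 + x ^ 2)⁻¹),
    integral_univ_inv_one_add_sq, abs_of_pos hν, smul_eq_mul, inv_mul_cancel_left₀ hν.ne']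

/-- A quantitative approximate-identity estimate for the Poisson kernel
`t ↦ ν/(π(t²+ν²))`: if `φ : ℝ → ℝ` is `C²`, integrable, with finite sup norms of `φ` and `φ''`,
then `|∫ (ν/(t²+ν²)) φ(t) dt − π φ(0)| ≤ C ν` for all `ν ∈ (0,1/2]`, where `C` depends only
on `‖φ‖_{L¹}`, `‖φ‖_∞` and `‖φ''‖_∞`. -/
theorem statement4 (A₁ A₂ A₃ : ℝ) :
    ∃ C : ℝ, ∀ φ : ℝ → ℝ, ContDiff ℝ 2 φ → Integrable φ →
      (∫ t : ℝ, |φ t|) ≤ A₁ → (∀ t, |φ t| ≤ A₂) → (∀ t, |deriv (deriv φ) t| ≤ A₃) →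
      ∀ ν ∈ Set.Ioc (0 : ℝ) (1 / 2),
        |(∫ t : ℝ, ν / (t ^ 2 + ν ^ 2) * φ t) - Real.pi * φ 0| ≤ C * ν := by
  refine ⟨(2 * A₃ + 4 * A₂) * Real.pi / 2, fun φ hφ _ _ h₂ h₃ ν hν => ?_⟩
  have hν0 : 0 < ν := hν.1
  have hK := integrable_poisson_kernel hν0
  have hKφ : Integrable fun t : ℝ => ν / (t ^ 2 + ν ^ 2) * φ t :=
    hK.mul_bdd hφ.continuous.aestronglyMeasurable (Filter.Eventually.of_forall h₂)
  have hKφ' : Integrable fun t : ℝ => ν / (t ^ 2 + ν ^ 2) * φ (-t) := by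
    simpa using hKφ.comp_neg
  have hreflect : ∫ t : ℝ, ν / (t ^ 2 + ν ^ 2) * φ (-t) = ∫ t : ℝ, ν / (t ^ 2 + ν ^ 2) * φ t := by
    rw [← integral_neg_eq_self (fun t : ℝ => ν / (t ^ 2 + ν ^ 2) * φ t)]
    exact integral_congr_ae (Filter.Eventually.of_forall fun t => by
      change _ = ν / ((-t) ^ 2 + ν ^ 2) * φ (-t)
      rw [neg_sq])
  have hsymm : ∫ t : ℝ, ν / (t ^ 2 + ν ^ 2) * (φ t + φ (-t) - 2 * φ 0) =
      2 * ((∫ t : ℝ, ν / (t ^ 2 + ν ^ 2) * φ t) - Real.pi * φ 0) := by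
    simp_rw [mul_sub, mul_add]
    rw [integral_sub (by exact hKφ.add hKφ') (hK.mul_const _), integral_add hKφ hKφ', hreflect,
      integral_mul_const, integral_poisson_kernel hν0]
    ring
  have hpoint : ∀ t : ℝ, ‖ν / (t ^ 2 + ν ^ 2) * (φ t + φ (-t) - 2 * φ 0)‖ ≤
      (2 * A₃ + 4 * A₂) * ν * (1 + t ^ 2)⁻¹ := by
    intro t
    have hq := abs_symm_second_diff_le hφ h₃ t
    have hb : |φ t + φ (-t) - 2 * φ 0| ≤ 4 * A₂ := by
      have h1 := abs_le.1 (h₂ t)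
      have h2 := abs_le.1 (h₂ (-t))
      have h3 := abs_le.1 (h₂ 0)
      exact abs_le.2 ⟨by linarith, by linarith⟩
    have hA₂ : 0 ≤ A₂ := (abs_nonneg _).trans (h₂ 0)
    have hA₃ : 0 ≤ A₃ := (abs_nonneg _).trans (h₃ 0)
    rw [norm_mul, Real.norm_of_nonneg (by positivity), Real.norm_eq_abs, ← div_eq_mul_inv,
      div_mul_eq_mul_div, div_le_div_iff₀ (by positivity) (by positivity)]
    have hmain : |φ t + φ (-t) - 2 * φ 0| * (1 + t ^ 2) ≤
        (2 * A₃ + 4 * A₂) * (t ^ 2 + ν ^ 2) := by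
      nlinarith [mul_le_mul_of_nonneg_right hb (sq_nonneg t), mul_nonneg hA₂ (sq_nonneg ν),
        mul_nonneg hA₃ (sq_nonneg ν)]
    nlinarith [mul_le_mul_of_nonneg_left hmain hν0.le]
  have hle := norm_integral_le_of_norm_le (integrable_inv_one_add_sq.const_mul _)
    (Filter.Eventually.of_forall hpoint)
  rw [hsymm, integral_const_mul, integral_univ_inv_one_add_sq, Real.norm_eq_abs, abs_mul,
    abs_two] at hle
  linarith
end

section
/- Let d ≥ 2 and r > d. Then there exists a constant C > 0 such that for every y ∈ C_r(ℝ^d): (i) for every s ∈ ℝ^d the double integral defining the wave kinetic integral K_s(y) converges absolutely; (ii) the function s ↦ K_s(y) is continuous on ℝ^d; and (iii) ‖K(y)‖_{r+1} ≤ C ‖y‖_r³, i.e. K maps C_r(ℝ^d) into C_{r+1}(ℝ^d) with a cubic bound. -/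
open MeasureTheory

noncomputable section

/-- `ℝ^d` with its Euclidean structure. -/
abbrev Rd (d : ℕ) := EuclideanSpace ℝ (Fin d)

/-- Integral of `f` over the hyperplane `x^⊥ = {z : x·z = 0}` with respect to the
`(d-1)`-dimensional Lebesgue measure induced by the Euclidean inner product. -/
noncomputable def hyperplaneIntegral (d : ℕ) (x : Rd d) (f : Rd d → ℝ) : ℝ :=
  ∫ z : ((ℝ ∙ x)ᗮ : Submodule ℝ (Rd d)), f (z : Rd d)

/-- The weighted sup-norm `‖y‖_r = sup_s (1+|s|)^r |y(s)|`. -/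
noncomputable def wNorm (d : ℕ) (r : ℝ) (y : Rd d → ℝ) : ℝ :=
  ⨆ s : Rd d, (1 + ‖s‖) ^ r * |y s|

/-- Membership in the space `C_r(ℝ^d)` of continuous functions with finite `‖·‖_r`. -/
def memCr (d : ℕ) (r : ℝ) (y : Rd d → ℝ) : Prop :=
  Continuous y ∧ ∃ K : ℝ, ∀ s : Rd d, (1 + ‖s‖) ^ r * |y s| ≤ K

/-- The integrand of the wave kinetic integral. -/
noncomputable def kinIntegrand (d : ℕ) (y : Rd d → ℝ) (s x z : Rd d) : ℝ :=
  y (s + x) * y (s + z) * y (s + x + z) + y (s + x) * y (s + z) * y s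
    - y (s + z) * y (s + x + z) * y s - y (s + x) * y (s + x + z) * y s

/-- The wave kinetic integral
`K_s(y) = 2π ∫_{ℝ^d} |x|⁻¹ (∫_{x^⊥} [...] dz) dx`. -/
noncomputable def Kwk (d : ℕ) (y : Rd d → ℝ) (s : Rd d) : ℝ :=
  2 * Real.pi * ∫ x : Rd d, ‖x‖⁻¹ * hyperplaneIntegral d x (kinIntegrand d y s x)

/-- The Japanese-bracket weight `(1+‖v‖)^{-r}`. -/
def japWeight {V : Type*} [NormedAddCommGroup V] (r : ℝ) (v : V) : ℝ := (1 + ‖v‖) ^ (-r)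

section Weight

variable {V : Type*} [NormedAddCommGroup V] {r : ℝ}

lemma japWeight_pos (r : ℝ) (v : V) : 0 < japWeight r v := by
  unfold japWeight; positivity

lemma japWeight_nonneg (r : ℝ) (v : V) : 0 ≤ japWeight r v := (japWeight_pos r v).le

lemma continuous_japWeight (r : ℝ) : Continuous (japWeight r : V → ℝ) := by
  unfold japWeight
  refine Continuous.rpow_const (by fun_prop) fun v => Or.inl ?_
  positivity

@[fun_prop]
lemma measurable_japWeight [MeasurableSpace V] [BorelSpace V] (r : ℝ) :
    Measurable (japWeight r : V → ℝ) := (continuous_japWeight r).measurable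

lemma japWeight_le_one (hr : 0 ≤ r) (v : V) : japWeight r v ≤ 1 :=
  Real.rpow_le_one_of_one_le_of_nonpos (by linarith [norm_nonneg v]) (by linarith)

lemma japWeight_anti {W : Type*} [NormedAddCommGroup W] (hr : 0 ≤ r) {v : V} {w : W}
    (h : ‖v‖ ≤ ‖w‖) : japWeight r w ≤ japWeight r v :=
  Real.rpow_le_rpow_of_nonpos (by positivity) (by linarith) (by linarith)

lemma japWeight_le_two_rpow_mul {W : Type*} [NormedAddCommGroup W] (hr : 0 ≤ r) {v : V} {w : W}
    (h : 1 + ‖v‖ ≤ 2 * (1 + ‖w‖)) : japWeight r w ≤ 2 ^ r * japWeight r v := by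
  have h1 : (2 * (1 + ‖w‖)) ^ (-r) ≤ (1 + ‖v‖) ^ (-r) :=
    Real.rpow_le_rpow_of_nonpos (by positivity) h (by linarith)
  rw [Real.mul_rpow (by positivity) (by positivity), Real.rpow_neg (by norm_num)] at h1
  rwa [inv_mul_le_iff₀ (by positivity)] at h1

lemma japWeight_add_le (hr : 0 ≤ r) (a b : V) :
    japWeight r (a + b) ≤ (1 + ‖a‖) ^ r * japWeight r b := by
  have h : 1 + ‖b‖ ≤ (1 + ‖a‖) * (1 + ‖a + b‖) := by
    have : ‖b‖ ≤ ‖a + b‖ + ‖a‖ := by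
      simpa using norm_sub_le (a + b) a
    nlinarith [norm_nonneg a, norm_nonneg (a + b)]
  have h1 : ((1 + ‖a‖) * (1 + ‖a + b‖)) ^ (-r) ≤ (1 + ‖b‖) ^ (-r) :=
    Real.rpow_le_rpow_of_nonpos (by positivity) h (by linarith)
  rw [Real.mul_rpow (by positivity) (by positivity), Real.rpow_neg (by positivity)] at h1
  rwa [inv_mul_le_iff₀ (by positivity)] at h1

/-- The weight at a point and at a point at distance at most one are comparable. -/
lemma japWeight_le_of_norm_sub_le_one (hr : 0 ≤ r) {a b : V} (h : ‖a - b‖ ≤ 1) :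
    japWeight r a ≤ 2 ^ r * japWeight r b := by
  refine japWeight_le_two_rpow_mul hr ?_
  have : ‖b‖ ≤ ‖a‖ + ‖a - b‖ := by
    simpa using norm_sub_le a (a - b)
  linarith [norm_nonneg a]

end Weight

section Integrals

variable {E G : Type*} [NormedAddCommGroup E] [InnerProductSpace ℝ E] [FiniteDimensional ℝ E]
  [NormedAddCommGroup G] [InnerProductSpace ℝ G] [FiniteDimensional ℝ G]
  [MeasurableSpace G] [BorelSpace G] {r : ℝ}

/-- Integrals of the weight over affine subspaces are maximal for linear subspaces. -/
lemma lintegral_japWeight_add_isometry_le (hr : 0 ≤ r) (L : G →ₗᵢ[ℝ] E) (a : E) :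
    ∫⁻ w : G, ENNReal.ofReal (japWeight r (a + L w)) ≤
      ∫⁻ w : G, ENNReal.ofReal (japWeight r w) := by
  set A := L.toContinuousLinearMap.adjoint with hA
  have hAL : ∀ w, A (L w) = w := fun w => by
    refine ext_inner_right ℝ fun v => ?_
    rw [hA, ContinuousLinearMap.adjoint_inner_left]
    exact L.inner_map_map w v
  have hAn : ∀ v, ‖A v‖ ≤ ‖v‖ := fun v => by
    have h1 : ‖A‖ ≤ 1 := by
      rw [hA, LinearIsometryEquiv.norm_map]
      exact L.norm_toContinuousLinearMap_le
    simpa using A.le_of_opNorm_le h1 v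
  calc ∫⁻ w : G, ENNReal.ofReal (japWeight r (a + L w))
      ≤ ∫⁻ w : G, ENNReal.ofReal (japWeight r (A a + w)) := by
        refine lintegral_mono fun w => ENNReal.ofReal_le_ofReal (japWeight_anti hr ?_)
        have := hAn (a + L w)
        rwa [map_add, hAL] at this
    _ = _ := lintegral_add_left_eq_self (fun w : G => ENNReal.ofReal (japWeight r w)) (A a)

variable [MeasurableSpace E] [BorelSpace E]

lemma integrable_japWeight (hr : (Module.finrank ℝ E : ℝ) < r) :
    Integrable (japWeight r : E → ℝ) := integrable_one_add_norm hr

/-- Fubini along the orthogonal decomposition into a line and the range of a linear isometry of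
codimension one. -/
lemma lintegral_eq_lintegral_line_hyperplane
    (hdim : Module.finrank ℝ E = Module.finrank ℝ G + 1) (L : G →ₗᵢ[ℝ] E) (u : E) (hu : ‖u‖ = 1)
    (hL : ∀ w, inner ℝ u (L w) = 0) (f : E → ENNReal) (hf : Measurable f) :
    ∫⁻ z, f z = ∫⁻ t : ℝ, ∫⁻ w : G, f (t • u + L w) := by
  let T : WithLp 2 (ℝ × G) →ₗ[ℝ] E :=
    { toFun := fun p => p.fst • u + L p.snd
      map_add' := fun p q => by simp [add_smul]; abel
      map_smul' := fun c p => by simp [mul_smul] }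
  have hT : ∀ p, ‖T p‖ = ‖p‖ := fun p => by
    have h1 : ‖T p‖ ^ 2 = ‖p‖ ^ 2 := by
      rw [WithLp.prod_norm_sq_eq_of_L2]
      change ‖p.fst • u + L p.snd‖ ^ 2 = _
      rw [norm_add_sq_real, inner_smul_left, hL, norm_smul, hu, L.norm_map]
      simp
    exact (sq_eq_sq₀ (norm_nonneg _) (norm_nonneg _)).1 h1
  let Ti : WithLp 2 (ℝ × G) →ₗᵢ[ℝ] E := ⟨T, hT⟩
  have hfin : Module.finrank ℝ (WithLp 2 (ℝ × G)) = Module.finrank ℝ E := by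
    rw [hdim, (WithLp.linearEquiv 2 ℝ (ℝ × G)).finrank_eq]
    simp [add_comm]
  let e := Ti.toLinearIsometryEquiv hfin
  have he : MeasurePreserving (fun p : ℝ × G => e (WithLp.toLp 2 p)) :=
    e.measurePreserving.comp (WithLp.volume_preserving_toLp ℝ G)
  rw [← he.lintegral_comp hf, Measure.volume_eq_prod, lintegral_prod]
  · rfl
  · exact (hf.comp he.measurable).aemeasurable

lemma integrableOn_inv_norm_ball (h2 : 2 ≤ Module.finrank ℝ E) (R : ℝ) :
    IntegrableOn (fun z : E => ‖z‖⁻¹) (Metric.ball 0 R) := by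
  have h2' : (2 : ℝ) ≤ Module.finrank ℝ E := by exact_mod_cast h2
  refine integrableOn_ball_of_norm_le_rpow (C := 1) (α := 1) (by omega) (by linarith) ?_ ?_
  · refine Filter.Eventually.of_forall fun z => ?_
    rw [Real.rpow_neg_one]; simp
  · exact measurable_norm.inv.aestronglyMeasurable

lemma integral_inv_norm_ball_eq (h2 : 2 ≤ Module.finrank ℝ E) {R : ℝ} (hR : 0 < R) :
    ∫ z : E in Metric.ball 0 R, ‖z‖⁻¹ =
      R ^ (Module.finrank ℝ E - 1) * ∫ z : E in Metric.ball 0 1, ‖z‖⁻¹ := by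
  have h := Measure.setIntegral_comp_smul_of_pos (volume : Measure E)
    (fun z : E => ‖z‖⁻¹) (Metric.ball 0 1) hR
  rw [smul_unitBall_of_pos hR] at h
  simp only [norm_smul, Real.norm_of_nonneg hR.le, mul_inv, integral_const_mul, smul_eq_mul] at h
  obtain ⟨n, hn⟩ : ∃ n, Module.finrank ℝ E = n + 1 := ⟨Module.finrank ℝ E - 1, by omega⟩
  rw [hn] at h ⊢
  rw [Nat.add_sub_cancel]
  generalize (∫ z : E in Metric.ball 0 R, ‖z‖⁻¹) = A at h ⊢
  generalize (∫ z : E in Metric.ball 0 1, ‖z‖⁻¹) = B at h ⊢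
  field_simp at h
  rw [pow_succ] at h
  exact mul_left_cancel₀ hR.ne' (by linarith)

/-- The Riesz potential of order `n - 1` of the weight decays like `(1+|s|)^{-1}`. -/
lemma lintegral_inv_norm_mul_japWeight_le (h2 : 2 ≤ Module.finrank ℝ E)
    (hr : (Module.finrank ℝ E : ℝ) < r) :
    ∃ C : ℝ, 0 < C ∧ ∀ s : E, ∫⁻ z : E, ENNReal.ofReal (‖z‖⁻¹ * japWeight r (s + z)) ≤
      ENNReal.ofReal (C * (1 + ‖s‖)⁻¹) := by
  have hr0 : 0 ≤ r := (Nat.cast_nonneg _).trans hr.le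
  set I₁ := ∫ z : E in Metric.ball 0 1, ‖z‖⁻¹ with hI₁
  set I₂ := ∫ z : E, japWeight r z with hI₂
  have hI₁0 : 0 ≤ I₁ := integral_nonneg fun z => by positivity
  have hI₂0 : 0 ≤ I₂ := integral_nonneg fun z => japWeight_nonneg r z
  refine ⟨2 ^ r * I₁ + 2 * I₂ + 1, by positivity, fun s => ?_⟩
  set R := (1 + ‖s‖) / 2 with hR
  have hRpos : 0 < R := by positivity
  set g : E → ℝ := fun z => 2 ^ r * japWeight r s * (Metric.ball 0 R).indicator (fun z => ‖z‖⁻¹) z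
    + R⁻¹ * japWeight r (s + z) with hg
  have hle : ∀ z, ‖z‖⁻¹ * japWeight r (s + z) ≤ g z := fun z => by
    by_cases hz : ‖z‖ < R
    · have h1 : japWeight r (s + z) ≤ 2 ^ r * japWeight r s := by
        refine japWeight_le_two_rpow_mul hr0 ?_
        have : ‖s‖ ≤ ‖s + z‖ + ‖z‖ := by simpa using norm_sub_le (s + z) z
        linarith
      have h2 : 0 ≤ R⁻¹ * japWeight r (s + z) :=
        mul_nonneg (by positivity) (japWeight_nonneg _ _)
      have h3 : z ∈ Metric.ball (0 : E) R := by simpa using hz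
      simp only [hg, Set.indicator_of_mem h3]
      nlinarith [mul_le_mul_of_nonneg_left h1 (inv_nonneg.2 (norm_nonneg z))]
    · have h3 : z ∉ Metric.ball (0 : E) R := by simpa using hz
      simp only [hg, Set.indicator_of_notMem h3, mul_zero, zero_add]
      gcongr
      · exact japWeight_nonneg _ _
      · exact not_lt.1 hz
  have hi₁ : Integrable (fun z : E => (Metric.ball 0 R).indicator (fun z => ‖z‖⁻¹) z) :=
    (integrableOn_inv_norm_ball h2 R).integrable_indicator Metric.isOpen_ball.measurableSet
  have hi₂ : Integrable (fun z : E => japWeight r (s + z)) :=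
    (integrable_japWeight hr).comp_add_left s
  have hgi : Integrable g := (hi₁.const_mul _).add (hi₂.const_mul _)
  have hg0 : ∀ z, 0 ≤ g z := fun z =>
    (mul_nonneg (by positivity) (japWeight_nonneg _ _)).trans (hle z)
  calc ∫⁻ z : E, ENNReal.ofReal (‖z‖⁻¹ * japWeight r (s + z))
      ≤ ∫⁻ z : E, ENNReal.ofReal (g z) :=
        lintegral_mono fun z => ENNReal.ofReal_le_ofReal (hle z)
    _ = ENNReal.ofReal (∫ z, g z) :=
        (ofReal_integral_eq_lintegral_ofReal hgi (Filter.Eventually.of_forall hg0)).symm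
    _ ≤ _ := ENNReal.ofReal_le_ofReal ?_
  have hint : ∫ z, g z =
      2 ^ r * japWeight r s * (R ^ (Module.finrank ℝ E - 1) * I₁) + R⁻¹ * I₂ := by
    rw [hg, integral_add (hi₁.const_mul _) (hi₂.const_mul _), integral_const_mul,
      integral_const_mul, integral_indicator Metric.isOpen_ball.measurableSet,
      integral_inv_norm_ball_eq h2 hRpos, integral_add_left_eq_self (japWeight r) s]
  have hdecay : japWeight r s * R ^ (Module.finrank ℝ E - 1) ≤ (1 + ‖s‖)⁻¹ := by
    have hs : 1 ≤ 1 + ‖s‖ := by linarith [norm_nonneg s]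
    calc japWeight r s * R ^ (Module.finrank ℝ E - 1)
        ≤ (1 + ‖s‖) ^ (-(Module.finrank ℝ E : ℝ)) * (1 + ‖s‖) ^ (Module.finrank ℝ E - 1) := by
          refine mul_le_mul (Real.rpow_le_rpow_of_exponent_le hs (by linarith))
            (pow_le_pow_left₀ hRpos.le (by linarith) _) (by positivity) (by positivity)
      _ = (1 + ‖s‖)⁻¹ := by
          obtain ⟨n, hn⟩ : ∃ n, Module.finrank ℝ E = n + 1 := ⟨Module.finrank ℝ E - 1, by omega⟩
          rw [hn, Real.rpow_neg (by positivity), Real.rpow_natCast, Nat.add_sub_cancel, pow_succ]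
          field_simp
  have hRinv : R⁻¹ = 2 * (1 + ‖s‖)⁻¹ := by rw [hR]; field_simp
  rw [hint, hRinv]
  have h3 := mul_le_mul_of_nonneg_left hdecay (by positivity : 0 ≤ 2 ^ r * I₁)
  have h4 : 0 ≤ (1 + ‖s‖)⁻¹ := by positivity
  nlinarith

/-- Fubini on the slab `{z : |x·z| ≤ ε}`. -/
lemma setLIntegral_slab
    (hdim : Module.finrank ℝ E = Module.finrank ℝ G + 1) (L : G →ₗᵢ[ℝ] E) {x : E} (hx : x ≠ 0)
    (hL : ∀ w, inner ℝ x (L w) = 0) (ε : ℝ) (f : E → ENNReal) (hf : Measurable f) :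
    ∫⁻ z in {z | |inner ℝ x z| ≤ ε}, f z =
      ∫⁻ t in Set.Icc (-(ε / ‖x‖)) (ε / ‖x‖), ∫⁻ w : G, f (t • (‖x‖⁻¹ • x) + L w) := by
  have hxn : 0 < ‖x‖ := norm_pos_iff.2 hx
  have hu : ‖‖x‖⁻¹ • x‖ = 1 := by
    rw [norm_smul, norm_inv, norm_norm, inv_mul_cancel₀ hxn.ne']
  have hS : MeasurableSet {z : E | |inner ℝ x z| ≤ ε} :=
    measurableSet_le (by fun_prop) measurable_const
  rw [← lintegral_indicator hS, lintegral_eq_lintegral_line_hyperplane hdim L _ hu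
    (fun w => by rw [inner_smul_left, hL, mul_zero]) _ (hf.indicator hS),
    ← lintegral_indicator measurableSet_Icc]
  refine lintegral_congr fun t => ?_
  have hmem : ∀ w, t • (‖x‖⁻¹ • x) + L w ∈ {z : E | |inner ℝ x z| ≤ ε} ↔
      t ∈ Set.Icc (-(ε / ‖x‖)) (ε / ‖x‖) := fun w => by
    have : inner ℝ x (t • (‖x‖⁻¹ • x) + L w) = t * ‖x‖ := by
      rw [inner_add_right, hL, inner_smul_right, inner_smul_right, real_inner_self_eq_norm_sq]
      field_simp
      ring
    rw [Set.mem_ofPred_eq, this, abs_mul, abs_norm, ← le_div_iff₀ hxn, abs_le, Set.mem_Icc]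
  by_cases ht : t ∈ Set.Icc (-(ε / ‖x‖)) (ε / ‖x‖)
  · rw [Set.indicator_of_mem ht]
    exact lintegral_congr fun w => Set.indicator_of_mem ((hmem w).2 ht) _
  · rw [Set.indicator_of_notMem ht]
    simp_rw [Set.indicator_of_notMem (mt (hmem _).1 ht)]
    simp

/-- A family of hyperplane integrals of the weight against a weight in the normal variable. -/
lemma lintegral_lintegral_normal_le (hr : 0 ≤ r) (L : E → G →ₗᵢ[ℝ] E) (s : E) (a : E → E) :
    ∫⁻ x : E, ∫⁻ w : G, ENNReal.ofReal
        (‖x‖⁻¹ * (japWeight r (s + x) * japWeight r (a x + L x w))) ≤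
      (∫⁻ w : G, ENNReal.ofReal (japWeight r w)) *
        ∫⁻ x : E, ENNReal.ofReal (‖x‖⁻¹ * japWeight r (s + x)) := by
  rw [← lintegral_const_mul _ (by fun_prop)]
  refine lintegral_mono fun x => ?_
  have h : 0 ≤ ‖x‖⁻¹ * japWeight r (s + x) := mul_nonneg (by positivity) (japWeight_nonneg _ _)
  simp_rw [← mul_assoc, ENNReal.ofReal_mul h]
  rw [lintegral_const_mul _ (by have := (L x).continuous.measurable; fun_prop), mul_comm]
  gcongr 1
  exact lintegral_japWeight_add_isometry_le hr (L x) _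

lemma lintegral_hyperplane_le_slab (hr : 0 ≤ r)
    (hdim : Module.finrank ℝ E = Module.finrank ℝ G + 1) (L : G →ₗᵢ[ℝ] E) {x : E}
    (hL : ∀ w, inner ℝ x (L w) = 0) {ε : ℝ} (hε : 0 < ε) (hx : ε ≤ ‖x‖) (s : E) :
    ENNReal.ofReal (2 * ε) * ∫⁻ w : G, ENNReal.ofReal
        (‖x‖⁻¹ * (japWeight r (s + L w) * japWeight r (s + x + L w))) ≤
      ENNReal.ofReal (2 ^ r * 2 ^ r) * ∫⁻ z in {z | |inner ℝ x z| ≤ ε},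
        ENNReal.ofReal (japWeight r (s + z) * japWeight r (s + x + z)) := by
  have hxn : 0 < ‖x‖ := hε.trans_le hx
  have hLm := L.continuous.measurable
  rw [setLIntegral_slab hdim L (norm_pos_iff.1 hxn) hL ε _ (by fun_prop)]
  have hvol : ENNReal.ofReal (2 * ε) * ∫⁻ w : G, ENNReal.ofReal
        (‖x‖⁻¹ * (japWeight r (s + L w) * japWeight r (s + x + L w))) =
      ∫⁻ _ in Set.Icc (-(ε / ‖x‖)) (ε / ‖x‖), ∫⁻ w : G, ENNReal.ofReal
        (japWeight r (s + L w) * japWeight r (s + x + L w)) := by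
    simp_rw [ENNReal.ofReal_mul (inv_nonneg.2 hxn.le)]
    rw [lintegral_const_mul' _ _ ENNReal.ofReal_ne_top, setLIntegral_const, Real.volume_Icc,
      ← mul_assoc, ← ENNReal.ofReal_mul (by positivity), mul_comm]
    congr 2
    ring
  rw [hvol, ← lintegral_const_mul' _ _ ENNReal.ofReal_ne_top]
  refine setLIntegral_mono_ae' measurableSet_Icc (Filter.Eventually.of_forall fun t ht => ?_)
  rw [← lintegral_const_mul' _ _ ENNReal.ofReal_ne_top]
  refine lintegral_mono fun w => ?_
  rw [← ENNReal.ofReal_mul (by positivity)]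
  refine ENNReal.ofReal_le_ofReal ?_
  have hnear : ∀ b : E, japWeight r (b + L w) ≤
      2 ^ r * japWeight r (b + (t • (‖x‖⁻¹ • x) + L w)) := fun b => by
    refine japWeight_le_of_norm_sub_le_one hr ?_
    have : b + L w - (b + (t • (‖x‖⁻¹ • x) + L w)) = -(t • (‖x‖⁻¹ • x)) := by abel
    rw [this, norm_neg, norm_smul, norm_smul, norm_inv, norm_norm, inv_mul_cancel₀ hxn.ne', mul_one,
      Real.norm_eq_abs]
    exact (abs_le.2 ht).trans ((div_le_one hxn).2 hx)
  have := mul_le_mul (hnear s) (hnear (s + x)) (japWeight_nonneg _ _)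
    (mul_nonneg (by positivity) (japWeight_nonneg _ _))
  linarith

lemma setLIntegral_slab_japWeight_le (hr : 0 ≤ r)
    (hdim : Module.finrank ℝ E = Module.finrank ℝ G + 1) (L : G →ₗᵢ[ℝ] E) {z : E}
    (hz : z ≠ 0) (hL : ∀ w, inner ℝ z (L w) = 0) {ε : ℝ} (hε : 0 < ε) (s : E) :
    ∫⁻ x in {x | |inner ℝ z x| ≤ ε},
        ENNReal.ofReal (japWeight r (s + z) * japWeight r (s + x + z)) ≤
      ENNReal.ofReal (2 * ε) * ((∫⁻ w : G, ENNReal.ofReal (japWeight r w)) *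
        ENNReal.ofReal (‖z‖⁻¹ * japWeight r (s + z))) := by
  have hzn : 0 < ‖z‖ := norm_pos_iff.2 hz
  rw [setLIntegral_slab hdim L hz hL ε _ (by fun_prop)]
  calc ∫⁻ t in Set.Icc (-(ε / ‖z‖)) (ε / ‖z‖), ∫⁻ w : G,
        ENNReal.ofReal (japWeight r (s + z) * japWeight r (s + (t • (‖z‖⁻¹ • z) + L w) + z))
      ≤ ∫⁻ _ in Set.Icc (-(ε / ‖z‖)) (ε / ‖z‖), ENNReal.ofReal (japWeight r (s + z)) *
          ∫⁻ w : G, ENNReal.ofReal (japWeight r w) := by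
        refine lintegral_mono fun t => ?_
        simp_rw [ENNReal.ofReal_mul (japWeight_nonneg r (s + z))]
        rw [lintegral_const_mul' _ _ ENNReal.ofReal_ne_top]
        gcongr 1
        refine le_trans (le_of_eq (lintegral_congr fun w => ?_))
          (lintegral_japWeight_add_isometry_le hr L (s + z + t • (‖z‖⁻¹ • z)))
        congr 2
        abel
    _ = _ := by
        have h : ε / ‖z‖ - -(ε / ‖z‖) = 2 * ε * ‖z‖⁻¹ := by ring
        rw [setLIntegral_const, Real.volume_Icc, h, ENNReal.ofReal_mul (by positivity),
          ENNReal.ofReal_mul (by positivity : 0 ≤ ‖z‖⁻¹)]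
        ring

lemma setLIntegral_rectangle_le [Nontrivial E] (hr : 0 ≤ r)
    (hdim : Module.finrank ℝ E = Module.finrank ℝ G + 1) (L : E → G →ₗᵢ[ℝ] E)
    (hL : ∀ x ≠ 0, ∀ w, inner ℝ x (L x w) = 0) {ε : ℝ} (hε : 0 < ε) (s : E) :
    ∫⁻ x in {x : E | ε ≤ ‖x‖}, ∫⁻ w : G, ENNReal.ofReal
        (‖x‖⁻¹ * (japWeight r (s + L x w) * japWeight r (s + x + L x w))) ≤
      ENNReal.ofReal (2 ^ r * 2 ^ r) * ((∫⁻ w : G, ENNReal.ofReal (japWeight r w)) *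
        ∫⁻ z : E, ENNReal.ofReal (‖z‖⁻¹ * japWeight r (s + z))) := by
  have hε0 : ENNReal.ofReal (2 * ε) ≠ 0 := by simpa using hε
  refine (ENNReal.mul_le_mul_iff_right hε0 ENNReal.ofReal_ne_top).1 ?_
  have hS : MeasurableSet {p : E × E | |inner ℝ p.1 p.2| ≤ ε} :=
    measurableSet_le (by fun_prop) measurable_const
  set F : E × E → ENNReal := {p : E × E | |inner ℝ p.1 p.2| ≤ ε}.indicator
    (fun p => ENNReal.ofReal (japWeight r (s + p.2) * japWeight r (s + p.1 + p.2))) with hF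
  have hFm : Measurable F := Measurable.indicator (by fun_prop) hS
  calc ENNReal.ofReal (2 * ε) * ∫⁻ x in {x : E | ε ≤ ‖x‖}, ∫⁻ w : G, ENNReal.ofReal
        (‖x‖⁻¹ * (japWeight r (s + L x w) * japWeight r (s + x + L x w)))
      ≤ ∫⁻ x in {x : E | ε ≤ ‖x‖}, ENNReal.ofReal (2 ^ r * 2 ^ r) * ∫⁻ z, F (x, z) := by
        rw [← lintegral_const_mul' _ _ ENNReal.ofReal_ne_top]
        refine setLIntegral_mono_ae' (measurableSet_le measurable_const measurable_norm)
          (Filter.Eventually.of_forall fun x hx => ?_)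
        have hx0 : x ≠ 0 := norm_pos_iff.1 (hε.trans_le hx)
        refine (lintegral_hyperplane_le_slab hr hdim (L x) (hL x hx0) hε hx s).trans_eq ?_
        rw [← lintegral_indicator (measurableSet_le (by fun_prop) measurable_const)]
        rfl
    _ ≤ ENNReal.ofReal (2 ^ r * 2 ^ r) * ∫⁻ x, ∫⁻ z, F (x, z) := by
        rw [← lintegral_const_mul' _ _ ENNReal.ofReal_ne_top]
        exact setLIntegral_le_lintegral _ _
    _ = ENNReal.ofReal (2 ^ r * 2 ^ r) * ∫⁻ z, ∫⁻ x, F (x, z) := by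
        rw [lintegral_lintegral_swap (f := fun x z => F (x, z)) hFm.aemeasurable]
    _ ≤ ENNReal.ofReal (2 ^ r * 2 ^ r) * ∫⁻ z, ENNReal.ofReal (2 * ε) *
          ((∫⁻ w : G, ENNReal.ofReal (japWeight r w)) *
            ENNReal.ofReal (‖z‖⁻¹ * japWeight r (s + z))) := by
        gcongr 1
        refine lintegral_mono_ae ?_
        filter_upwards [Measure.ae_ne volume (0 : E)] with z hz
        refine le_trans (le_of_eq ?_)
          (setLIntegral_slab_japWeight_le hr hdim (L z) hz (hL z hz) hε s)
        rw [← lintegral_indicator (measurableSet_le (by fun_prop) measurable_const)]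
        refine lintegral_congr fun x => ?_
        simp only [hF, Set.indicator_apply, Set.mem_ofPred_eq, real_inner_comm]
    _ = _ := by
        rw [lintegral_const_mul' _ _ ENNReal.ofReal_ne_top, lintegral_const_mul _ (by fun_prop)]
        ring

lemma lintegral_rectangle_le [Nontrivial E] (hr : 0 ≤ r)
    (hdim : Module.finrank ℝ E = Module.finrank ℝ G + 1) (L : E → G →ₗᵢ[ℝ] E)
    (hL : ∀ x ≠ 0, ∀ w, inner ℝ x (L x w) = 0) (s : E) :
    ∫⁻ x : E, ∫⁻ w : G, ENNReal.ofReal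
        (‖x‖⁻¹ * (japWeight r (s + L x w) * japWeight r (s + x + L x w))) ≤
      ENNReal.ofReal (2 ^ r * 2 ^ r) * ((∫⁻ w : G, ENNReal.ofReal (japWeight r w)) *
        ∫⁻ z : E, ENNReal.ofReal (‖z‖⁻¹ * japWeight r (s + z))) := by
  have hU : ∀ᵐ x : E, x ∈ ⋃ n : ℕ, {x : E | 1 / ((n : ℝ) + 1) ≤ ‖x‖} := by
    filter_upwards [Measure.ae_ne volume (0 : E)] with x hx
    obtain ⟨n, hn⟩ := exists_nat_one_div_lt (norm_pos_iff.2 hx)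
    exact Set.mem_iUnion.2 ⟨n, hn.le⟩
  have hU' : (⋃ n : ℕ, {x : E | 1 / ((n : ℝ) + 1) ≤ ‖x‖}) =ᵐ[volume] Set.univ :=
    Filter.eventuallyEq_univ.2 hU
  rw [← setLIntegral_univ, ← setLIntegral_congr hU',
    setLIntegral_iUnion_of_directed]
  · exact iSup_le fun n => setLIntegral_rectangle_le hr hdim L hL (by positivity) s
  · refine Monotone.directed_le fun m n hmn x hx => ?_
    exact (show 1 / ((n : ℝ) + 1) ≤ 1 / ((m : ℝ) + 1) by gcongr).trans hx

end Integrals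

/-- A measurable choice of isometric parametrizations of the hyperplanes `x^⊥`. -/
lemma exists_hyperplane_frame {d : ℕ} (hd : 1 ≤ d) :
    ∃ L : Rd d → (Rd (d - 1) →ₗᵢ[ℝ] Rd d),
      Measurable (fun p : Rd d × Rd (d - 1) => L p.1 p.2) ∧
      ∀ x ≠ 0, ∀ w, inner ℝ x (L x w) = 0 := by
  have : NeZero d := ⟨by omega⟩
  let e : Rd d := EuclideanSpace.single 0 1
  have he : ‖e‖ = 1 := by simp [e]
  have he0 : e ≠ 0 := fun h => by simp [h] at he
  have : Fact (Module.finrank ℝ (Rd d) = d - 1 + 1) := ⟨by rw [finrank_euclideanSpace_fin]; omega⟩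
  let ι : Rd (d - 1) →ₗᵢ[ℝ] Rd d := (ℝ ∙ e)ᗮ.subtypeₗᵢ.comp
    (OrthonormalBasis.fromOrthogonalSpanSingleton (𝕜 := ℝ) (d - 1) he0).repr.symm.toLinearIsometry
  have hι : ∀ w, inner ℝ e (ι w) = 0 := fun w =>
    Submodule.mem_orthogonal_singleton_iff_inner_right.1 (Subtype.property _)
  let u : Rd d → Rd d := fun x => e - ‖x‖⁻¹ • x
  refine ⟨fun x => (ℝ ∙ u x)ᗮ.reflection.toLinearIsometry.comp ι, ?_, fun x hx w => ?_⟩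
  · have hform : (fun p : Rd d × Rd (d - 1) =>
        ((ℝ ∙ u p.1)ᗮ.reflection.toLinearIsometry.comp ι) p.2) = fun p =>
        -(2 • (inner ℝ (u p.1) (ι p.2) / ‖u p.1‖ ^ 2) • u p.1 - ι p.2) := by
      funext p
      simp [Submodule.reflection_orthogonal_apply, Submodule.reflection_singleton_apply]
    rw [hform]
    have hu : Measurable u := by
      change Measurable fun x : Rd d => e - ‖x‖⁻¹ • x
      fun_prop
    have hιm : Measurable ι := ι.continuous.measurable
    fun_prop
  · have hnorm : ‖e‖ = ‖‖x‖⁻¹ • x‖ := by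
      rw [he, norm_smul, norm_inv, norm_norm, inv_mul_cancel₀ (norm_ne_zero_iff.2 hx)]
    have hmap : (ℝ ∙ u x)ᗮ.reflection e = ‖x‖⁻¹ • x := Submodule.reflection_sub hnorm
    have h := (ℝ ∙ u x)ᗮ.reflection.inner_map_map e (ι w)
    rw [hmap, hι, inner_smul_left] at h
    exact (mul_eq_zero.1 h).resolve_left (by simpa using hx)

/-- The sum of the products of the weights at two of the three vertices `s+x`, `s+z`, `s+x+z` of a
rectangle. -/
def rectWeight {V : Type*} [NormedAddCommGroup V] (r : ℝ) (s x z : V) : ℝ :=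
  japWeight r (s + x) * japWeight r (s + z) + japWeight r (s + x) * japWeight r (s + x + z)
    + japWeight r (s + z) * japWeight r (s + x + z)

lemma rectWeight_nonneg {V : Type*} [NormedAddCommGroup V] (r : ℝ) (s x z : V) :
    0 ≤ rectWeight r s x z := by
  have h := fun v : V => japWeight_nonneg r v
  unfold rectWeight
  have h1 := h (s + x); have h2 := h (s + z); have h3 := h (s + x + z)
  positivity

lemma rectWeight_le_of_norm_sub_le_one {V : Type*} [NormedAddCommGroup V] {r : ℝ} (hr : 0 ≤ r)
    {s t : V} (h : ‖s - t‖ ≤ 1) (x z : V) :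
    rectWeight r s x z ≤ 2 ^ r * 2 ^ r * rectWeight r t x z := by
  have hv : ∀ v, japWeight r (s + v) ≤ 2 ^ r * japWeight r (t + v) := fun v =>
    japWeight_le_of_norm_sub_le_one hr (by rwa [add_sub_add_right_eq_sub])
  have h3 : japWeight r (s + x + z) ≤ 2 ^ r * japWeight r (t + x + z) := by
    simpa only [add_assoc] using hv (x + z)
  have hmul : ∀ {a b a' b' : V}, japWeight r a ≤ 2 ^ r * japWeight r a' →
      japWeight r b ≤ 2 ^ r * japWeight r b' →
      japWeight r a * japWeight r b ≤ 2 ^ r * 2 ^ r * (japWeight r a' * japWeight r b') :=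
    fun ha hb => (mul_le_mul ha hb (japWeight_nonneg _ _)
      (mul_nonneg (by positivity) (japWeight_nonneg _ _))).trans_eq (by ring)
  unfold rectWeight
  linarith [hmul (hv x) (hv z), hmul (hv x) h3, hmul (hv z) h3]

lemma rectWeight_le {V : Type*} [NormedAddCommGroup V] {r : ℝ} (hr : 0 ≤ r) (s x z : V) :
    rectWeight r s x z ≤ 2 * japWeight r (s + z) + japWeight r (s + x + z) := by
  unfold rectWeight
  have h1 := japWeight_le_one hr (s + x)
  have h2 := japWeight_le_one hr (s + x + z)
  have h3 := japWeight_nonneg r (s + z)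
  have h4 := japWeight_nonneg r (s + x + z)
  nlinarith [mul_le_mul_of_nonneg_right h1 h3, mul_le_mul_of_nonneg_right h1 h4,
    mul_le_mul_of_nonneg_right h2 h3]

/-- In a rectangle, one of the two neighbours of a vertex is at least half as far from the origin as
the vertex itself. -/
lemma exists_neighbour_norm_le {V : Type*} [NormedAddCommGroup V] [InnerProductSpace ℝ V]
    (s : V) {x z : V} (hxz : inner ℝ x z = 0) :
    1 + ‖s‖ ≤ 2 * (1 + ‖s + x‖) ∨ 1 + ‖s‖ ≤ 2 * (1 + ‖s + z‖) := by
  by_contra! h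
  obtain ⟨h1, h2⟩ := h
  have h3 : ‖s‖ ^ 2 + ‖s + x + z‖ ^ 2 = ‖s + x‖ ^ 2 + ‖s + z‖ ^ 2 := by
    rw [norm_add_sq_real (s + x) z, norm_add_sq_real s x, norm_add_sq_real s z, inner_add_left, hxz]
    ring
  nlinarith [norm_nonneg s, norm_nonneg (s + x), norm_nonneg (s + z), sq_nonneg ‖s + x + z‖]

lemma abs_kinIntegrand_le {d : ℕ} {r K : ℝ} (hr : 0 ≤ r) (hK : 0 ≤ K) {y : Rd d → ℝ}
    (hy : ∀ v, |y v| ≤ K * japWeight r v) (s : Rd d) {x z : Rd d} (hxz : inner ℝ x z = 0) :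
    |kinIntegrand d y s x z| ≤ K ^ 3 * (1 + 2 ^ r) * japWeight r s * rectWeight r s x z := by
  have h3 : ∀ a b c, |y a * y b * y c| ≤ K ^ 3 * (japWeight r a * japWeight r b * japWeight r c) :=
    fun a b c => by
    rw [abs_mul, abs_mul]
    calc |y a| * |y b| * |y c|
        ≤ (K * japWeight r a) * (K * japWeight r b) * (K * japWeight r c) := by
          have := japWeight_nonneg r a
          have := japWeight_nonneg r b
          gcongr <;> apply hy
      _ = _ := by ring
  have hs := japWeight_nonneg r s
  have ha := japWeight_nonneg r (s + x)
  have hb := japWeight_nonneg r (s + z)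
  have hc := japWeight_nonneg r (s + x + z)
  have htriple : japWeight r (s + x) * japWeight r (s + z) * japWeight r (s + x + z) ≤
      2 ^ r * japWeight r s * rectWeight r s x z := by
    have hfar : ∀ a b : ℝ, 0 ≤ b → a ≤ 2 ^ r * japWeight r s → b ≤ rectWeight r s x z →
        a * b ≤ 2 ^ r * japWeight r s * rectWeight r s x z := fun a b hb0 ha hb =>
      mul_le_mul ha hb hb0 (by positivity)
    rcases exists_neighbour_norm_le s hxz with h | h
    · rw [mul_assoc]
      refine hfar _ _ (by positivity) (japWeight_le_two_rpow_mul hr h) ?_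
      unfold rectWeight
      linarith [mul_nonneg ha hb, mul_nonneg ha hc]
    · rw [mul_comm (japWeight r (s + x)), mul_assoc]
      refine hfar _ _ (by positivity) (japWeight_le_two_rpow_mul hr h) ?_
      unfold rectWeight
      linarith [mul_nonneg ha hb, mul_nonneg hb hc]
  have h1 := abs_le.1 (h3 (s + x) (s + z) (s + x + z))
  have h2 := abs_le.1 (h3 (s + x) (s + z) s)
  have h4 := abs_le.1 (h3 (s + z) (s + x + z) s)
  have h5 := abs_le.1 (h3 (s + x) (s + x + z) s)
  have h6 := mul_le_mul_of_nonneg_left htriple (pow_nonneg hK 3)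
  have h7 : K ^ 3 * (1 + 2 ^ r) * japWeight r s * rectWeight r s x z =
      K ^ 3 * (2 ^ r * japWeight r s * rectWeight r s x z) +
      K ^ 3 * (japWeight r (s + x) * japWeight r (s + z) * japWeight r s) +
      K ^ 3 * (japWeight r (s + z) * japWeight r (s + x + z) * japWeight r s) +
      K ^ 3 * (japWeight r (s + x) * japWeight r (s + x + z) * japWeight r s) := by
    unfold rectWeight; ring
  rw [h7]
  unfold kinIntegrand
  rw [abs_le]
  constructor <;> linarith

lemma abs_le_wNorm_mul_japWeight {d : ℕ} {r : ℝ} {y : Rd d → ℝ} (hy : memCr d r y) (s : Rd d) :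
    |y s| ≤ wNorm d r y * japWeight r s := by
  obtain ⟨K, hK⟩ := hy.2
  have h : (1 + ‖s‖) ^ r * |y s| ≤ wNorm d r y :=
    le_ciSup (f := fun s : Rd d => (1 + ‖s‖) ^ r * |y s|) ⟨K, Set.forall_mem_range.2 hK⟩ s
  unfold japWeight
  rw [Real.rpow_neg (by positivity), ← div_eq_mul_inv, le_div_iff₀ (by positivity), mul_comm]
  exact h

lemma wNorm_nonneg (d : ℕ) (r : ℝ) (y : Rd d → ℝ) : 0 ≤ wNorm d r y :=
  Real.iSup_nonneg fun s => by positivity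

lemma continuous_kinIntegrand {d : ℕ} {y : Rd d → ℝ} (hy : Continuous y) :
    Continuous fun p : Rd d × Rd d × Rd d => kinIntegrand d y p.1 p.2.1 p.2.2 := by
  unfold kinIntegrand
  fun_prop

lemma integrable_kinIntegrand_hyperplane {d : ℕ} {r : ℝ} (hr : (d : ℝ) < r) {y : Rd d → ℝ}
    (hy : memCr d r y) (s x : Rd d) :
    Integrable fun z : ((ℝ ∙ x)ᗮ : Submodule ℝ (Rd d)) => kinIntegrand d y s x z := by
  have hr0 : 0 ≤ r := (Nat.cast_nonneg _).trans hr.le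
  have hcont := continuous_kinIntegrand hy.1
  have hW : Integrable (japWeight r : ((ℝ ∙ x)ᗮ : Submodule ℝ (Rd d)) → ℝ) := by
    refine integrable_japWeight (lt_of_le_of_lt ?_ hr)
    have := Submodule.finrank_le (ℝ ∙ x)ᗮ
    rw [finrank_euclideanSpace_fin] at this
    exact_mod_cast this
  have hshift : ∀ a : Rd d, Integrable
      fun z : ((ℝ ∙ x)ᗮ : Submodule ℝ (Rd d)) => japWeight r (a + z) := fun a => by
    refine (hW.const_mul ((1 + ‖a‖) ^ r)).mono' ?_ (Filter.Eventually.of_forall fun z => ?_)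
    · have := continuous_japWeight (V := Rd d) r
      exact Continuous.aestronglyMeasurable (by fun_prop)
    · rw [Real.norm_of_nonneg (japWeight_nonneg _ _)]
      exact japWeight_add_le hr0 a z
  refine ((((hshift s).const_mul 2).add (hshift (s + x))).const_mul
    (wNorm d r y ^ 3 * (1 + 2 ^ r) * japWeight r s)).mono' ?_
    (Filter.Eventually.of_forall fun z => ?_)
  · exact (hcont.comp (by fun_prop : Continuous fun z : ((ℝ ∙ x)ᗮ : Submodule ℝ (Rd d)) =>
      (s, x, (z : Rd d)))).aestronglyMeasurable
  · have hxz : inner ℝ x (z : Rd d) = 0 :=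
      Submodule.mem_orthogonal_singleton_iff_inner_right.1 z.2
    refine (abs_kinIntegrand_le hr0 (wNorm_nonneg d r y) (abs_le_wNorm_mul_japWeight hy) s
      hxz).trans ?_
    have := wNorm_nonneg d r y
    have := japWeight_nonneg r s
    exact mul_le_mul_of_nonneg_left (rectWeight_le hr0 s x z) (by positivity)

lemma hyperplaneIntegral_eq {d : ℕ} (hd : 1 ≤ d) (L : Rd (d - 1) →ₗᵢ[ℝ] Rd d) {x : Rd d}
    (hx : x ≠ 0) (hL : ∀ w, inner ℝ x (L w) = 0) (f : Rd d → ℝ) :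
    hyperplaneIntegral d x f = ∫ w, f (L w) := by
  have hmem : ∀ w, L w ∈ (ℝ ∙ x)ᗮ := fun w =>
    Submodule.mem_orthogonal_singleton_iff_inner_right.2 (hL w)
  let L' : Rd (d - 1) →ₗᵢ[ℝ] ((ℝ ∙ x)ᗮ : Submodule ℝ (Rd d)) :=
    ⟨L.toLinearMap.codRestrict _ hmem, fun w => L.norm_map w⟩
  have hfin : Module.finrank ℝ (Rd (d - 1)) = Module.finrank ℝ ((ℝ ∙ x)ᗮ : Submodule ℝ (Rd d)) := by
    have h := Submodule.finrank_add_finrank_orthogonal (ℝ ∙ x)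
    rw [finrank_span_singleton hx, finrank_euclideanSpace_fin] at h
    rw [finrank_euclideanSpace_fin]; omega
  let e := L'.toLinearIsometryEquiv hfin
  exact (e.measurePreserving.integral_comp e.toHomeomorph.measurableEmbedding
    (fun z => f (z : Rd d))).symm

section Frame

variable {d : ℕ} {r : ℝ} {L : Rd d → (Rd (d - 1) →ₗᵢ[ℝ] Rd d)}

lemma measurable_rectWeight_frame
    (hLm : Measurable fun p : Rd d × Rd (d - 1) => L p.1 p.2) (s : Rd d) :
    Measurable fun p : Rd d × Rd (d - 1) => ‖p.1‖⁻¹ * rectWeight r s p.1 (L p.1 p.2) := by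
  unfold rectWeight
  fun_prop

lemma exists_lintegral_rectWeight_le (hd : 2 ≤ d) (hr : (d : ℝ) < r)
    (hLm : Measurable fun p : Rd d × Rd (d - 1) => L p.1 p.2)
    (hL : ∀ x ≠ 0, ∀ w, inner ℝ x (L x w) = 0) :
    ∃ C : ℝ, 0 < C ∧ ∀ s : Rd d, ∫⁻ p : Rd d × Rd (d - 1),
      ENNReal.ofReal (‖p.1‖⁻¹ * rectWeight r s p.1 (L p.1 p.2)) ≤
        ENNReal.ofReal (C * (1 + ‖s‖)⁻¹) := by
  have hr0 : 0 ≤ r := (Nat.cast_nonneg _).trans hr.le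
  have hdim : Module.finrank ℝ (Rd d) = Module.finrank ℝ (Rd (d - 1)) + 1 := by
    rw [finrank_euclideanSpace_fin, finrank_euclideanSpace_fin]; omega
  have : Nontrivial (Rd d) := Module.nontrivial_of_finrank_pos (R := ℝ) (by omega)
  obtain ⟨C, hC, hCs⟩ := lintegral_inv_norm_mul_japWeight_le (E := Rd d) (r := r)
    (by rwa [finrank_euclideanSpace_fin]) (by rwa [finrank_euclideanSpace_fin])
  set I := ∫ w : Rd (d - 1), japWeight r w with hI
  have hI0 : 0 ≤ I := integral_nonneg fun w => japWeight_nonneg r w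
  have hIeq : ∫⁻ w : Rd (d - 1), ENNReal.ofReal (japWeight r w) = ENNReal.ofReal I := by
    refine (ofReal_integral_eq_lintegral_ofReal (integrable_japWeight ?_)
      (Filter.Eventually.of_forall (japWeight_nonneg r))).symm
    refine lt_of_le_of_lt ?_ hr
    rw [finrank_euclideanSpace_fin]
    exact_mod_cast d.sub_le 1
  refine ⟨(2 * I + 2 ^ r * 2 ^ r * I) * C + 1, by positivity, fun s => ?_⟩
  have hA := lintegral_lintegral_normal_le hr0 L s (fun _ => s)
  have hB := lintegral_lintegral_normal_le hr0 L s (fun x => s + x)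
  have hD := lintegral_rectangle_le hr0 hdim L hL s
  set N := ∫⁻ x : Rd d, ENNReal.ofReal (‖x‖⁻¹ * japWeight r (s + x)) with hN
  have hsplit : ∀ p : Rd d × Rd (d - 1),
      ENNReal.ofReal (‖p.1‖⁻¹ * rectWeight r s p.1 (L p.1 p.2)) =
      ENNReal.ofReal (‖p.1‖⁻¹ * (japWeight r (s + p.1) * japWeight r (s + L p.1 p.2))) +
      ENNReal.ofReal (‖p.1‖⁻¹ * (japWeight r (s + p.1) * japWeight r (s + p.1 + L p.1 p.2))) +
      ENNReal.ofReal
        (‖p.1‖⁻¹ * (japWeight r (s + L p.1 p.2) * japWeight r (s + p.1 + L p.1 p.2))) := fun p => by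
    have h := fun v : Rd d => japWeight_nonneg r v
    have h1 := h (s + p.1); have h2 := h (s + L p.1 p.2); have h3 := h (s + p.1 + L p.1 p.2)
    rw [← ENNReal.ofReal_add (by positivity) (by positivity),
      ← ENNReal.ofReal_add (by positivity) (by positivity), ← mul_add, ← mul_add]
    rfl
  simp_rw [hsplit]
  rw [lintegral_add_left (by fun_prop), lintegral_add_left (by fun_prop), Measure.volume_eq_prod,
    lintegral_prod _ (Measurable.aemeasurable (by fun_prop)),
    lintegral_prod _ (Measurable.aemeasurable (by fun_prop)),
    lintegral_prod _ (Measurable.aemeasurable (by fun_prop))]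
  refine (add_le_add (add_le_add hA hB) hD).trans ?_
  calc _ = ENNReal.ofReal (2 * I + 2 ^ r * 2 ^ r * I) * N := by
        rw [hIeq, ENNReal.ofReal_add (by positivity) (by positivity),
          ENNReal.ofReal_mul (by positivity : (0 : ℝ) ≤ 2 ^ r * 2 ^ r),
          ENNReal.ofReal_mul zero_le_two, ENNReal.ofReal_ofNat]
        ring
    _ ≤ ENNReal.ofReal (2 * I + 2 ^ r * 2 ^ r * I) * ENNReal.ofReal (C * (1 + ‖s‖)⁻¹) := by
        gcongr
        exact hCs s
    _ ≤ _ := by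
        rw [← ENNReal.ofReal_mul (by positivity)]
        refine ENNReal.ofReal_le_ofReal ?_
        have : 0 ≤ (1 + ‖s‖)⁻¹ := by positivity
        nlinarith

lemma integrable_rectWeight_frame (hd : 2 ≤ d) (hr : (d : ℝ) < r)
    (hLm : Measurable fun p : Rd d × Rd (d - 1) => L p.1 p.2)
    (hL : ∀ x ≠ 0, ∀ w, inner ℝ x (L x w) = 0) (s : Rd d) :
    Integrable fun p : Rd d × Rd (d - 1) => ‖p.1‖⁻¹ * rectWeight r s p.1 (L p.1 p.2) := by
  obtain ⟨C, -, hC⟩ := exists_lintegral_rectWeight_le hd hr hLm hL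
  refine ⟨(measurable_rectWeight_frame hLm s).aestronglyMeasurable, ?_⟩
  rw [hasFiniteIntegral_iff_ofReal (Filter.Eventually.of_forall fun p =>
    mul_nonneg (by positivity) (rectWeight_nonneg _ _ _ _))]
  exact (hC s).trans_lt ENNReal.ofReal_lt_top

lemma inv_norm_mul_hyperplaneIntegral_eq (hd : 1 ≤ d) (hL : ∀ x ≠ 0, ∀ w, inner ℝ x (L x w) = 0)
    (f : Rd d → Rd d → ℝ) (x : Rd d) :
    ‖x‖⁻¹ * hyperplaneIntegral d x (f x) = ∫ w, ‖x‖⁻¹ * f x (L x w) := by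
  rw [integral_const_mul]
  rcases eq_or_ne x 0 with rfl | hx
  · simp
  · rw [hyperplaneIntegral_eq hd (L x) hx (hL x hx)]

lemma norm_kinIntegrand_frame_le (hr : 0 ≤ r) (hL : ∀ x ≠ 0, ∀ w, inner ℝ x (L x w) = 0)
    {y : Rd d → ℝ} (hy : memCr d r y) (s : Rd d) (p : Rd d × Rd (d - 1)) :
    ‖‖p.1‖⁻¹ * kinIntegrand d y s p.1 (L p.1 p.2)‖ ≤
      wNorm d r y ^ 3 * (1 + 2 ^ r) * japWeight r s *
        (‖p.1‖⁻¹ * rectWeight r s p.1 (L p.1 p.2)) := by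
  rcases eq_or_ne p.1 0 with hp | hp
  · simp [hp]
  · rw [norm_mul, norm_inv, norm_norm, Real.norm_eq_abs, mul_left_comm]
    gcongr
    exact abs_kinIntegrand_le hr (wNorm_nonneg d r y) (abs_le_wNorm_mul_japWeight hy) s (hL _ hp _)

lemma measurable_kinIntegrand_frame
    (hLm : Measurable fun p : Rd d × Rd (d - 1) => L p.1 p.2) {y : Rd d → ℝ} (hy : Continuous y)
    (s : Rd d) :
    Measurable fun p : Rd d × Rd (d - 1) => ‖p.1‖⁻¹ * kinIntegrand d y s p.1 (L p.1 p.2) := by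
  have := hy.measurable
  unfold kinIntegrand
  fun_prop

lemma integrable_kinIntegrand_frame (hd : 2 ≤ d) (hr : (d : ℝ) < r)
    (hLm : Measurable fun p : Rd d × Rd (d - 1) => L p.1 p.2)
    (hL : ∀ x ≠ 0, ∀ w, inner ℝ x (L x w) = 0) {y : Rd d → ℝ} (hy : memCr d r y) (s : Rd d) :
    Integrable fun p : Rd d × Rd (d - 1) => ‖p.1‖⁻¹ * kinIntegrand d y s p.1 (L p.1 p.2) :=
  ((integrable_rectWeight_frame hd hr hLm hL s).const_mul _).mono'
    (measurable_kinIntegrand_frame hLm hy.1 s).aestronglyMeasurable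
    (Filter.Eventually.of_forall fun p =>
      norm_kinIntegrand_frame_le ((Nat.cast_nonneg _).trans hr.le) hL hy s p)

lemma Kwk_eq_integral_frame (hd : 2 ≤ d) (hr : (d : ℝ) < r)
    (hLm : Measurable fun p : Rd d × Rd (d - 1) => L p.1 p.2)
    (hL : ∀ x ≠ 0, ∀ w, inner ℝ x (L x w) = 0) {y : Rd d → ℝ} (hy : memCr d r y) (s : Rd d) :
    Kwk d y s = 2 * Real.pi *
      ∫ p : Rd d × Rd (d - 1), ‖p.1‖⁻¹ * kinIntegrand d y s p.1 (L p.1 p.2) := by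
  have h := integrable_kinIntegrand_frame hd hr hLm hL hy s
  rw [Measure.volume_eq_prod] at h ⊢
  rw [integral_prod _ h, Kwk]
  simp_rw [inv_norm_mul_hyperplaneIntegral_eq (by omega) hL (kinIntegrand d y s)]

lemma continuous_Kwk (hd : 2 ≤ d) (hr : (d : ℝ) < r)
    (hLm : Measurable fun p : Rd d × Rd (d - 1) => L p.1 p.2)
    (hL : ∀ x ≠ 0, ∀ w, inner ℝ x (L x w) = 0) {y : Rd d → ℝ} (hy : memCr d r y) :
    Continuous (Kwk d y) := by
  have hr0 : 0 ≤ r := (Nat.cast_nonneg _).trans hr.le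
  rw [funext (Kwk_eq_integral_frame hd hr hLm hL hy)]
  refine continuous_const.mul (continuous_iff_continuousAt.2 fun t => ?_)
  refine continuousAt_of_dominated (bound := fun p : Rd d × Rd (d - 1) =>
    wNorm d r y ^ 3 * (1 + 2 ^ r) * (2 ^ r * 2 ^ r) *
      (‖p.1‖⁻¹ * rectWeight r t p.1 (L p.1 p.2))) ?_ ?_ ?_ ?_
  · exact Filter.Eventually.of_forall fun s =>
      (measurable_kinIntegrand_frame hLm hy.1 s).aestronglyMeasurable
  · filter_upwards [Metric.closedBall_mem_nhds t one_pos] with s hs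
    rw [mem_closedBall_iff_norm] at hs
    refine Filter.Eventually.of_forall fun p => (norm_kinIntegrand_frame_le hr0 hL hy s p).trans ?_
    have hK := wNorm_nonneg d r y
    have hn : 0 ≤ ‖p.1‖⁻¹ * rectWeight r s p.1 (L p.1 p.2) :=
      mul_nonneg (by positivity) (rectWeight_nonneg _ _ _ _)
    calc wNorm d r y ^ 3 * (1 + 2 ^ r) * japWeight r s *
          (‖p.1‖⁻¹ * rectWeight r s p.1 (L p.1 p.2))
        ≤ wNorm d r y ^ 3 * (1 + 2 ^ r) * 1 * (‖p.1‖⁻¹ * rectWeight r s p.1 (L p.1 p.2)) := by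
          gcongr
          exact japWeight_le_one hr0 s
      _ ≤ wNorm d r y ^ 3 * (1 + 2 ^ r) * 1 *
          (‖p.1‖⁻¹ * (2 ^ r * 2 ^ r * rectWeight r t p.1 (L p.1 p.2))) := by
          gcongr
          exact rectWeight_le_of_norm_sub_le_one hr0 hs _ _
      _ = _ := by ring
  · exact (integrable_rectWeight_frame hd hr hLm hL t).const_mul _
  · refine Filter.Eventually.of_forall fun p => ?_
    have h := (continuous_kinIntegrand hy.1).comp
      (by fun_prop : Continuous fun s : Rd d => (s, p.1, L p.1 p.2))
    exact (continuous_const.mul h).continuousAt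

end Frame

/-- For `d ≥ 2` and `r > d` there is `C > 0` such that for every
`y ∈ C_r(ℝ^d)`: the double integral defining `K_s(y)` converges absolutely for every `s`;
`s ↦ K_s(y)` is continuous; and `‖K(y)‖_{r+1} ≤ C ‖y‖_r³`. -/
theorem statement5 (d : ℕ) (hd : 2 ≤ d) (r : ℝ) (hr : (d : ℝ) < r) :
    ∃ C : ℝ, 0 < C ∧ ∀ y : Rd d → ℝ, memCr d r y →
      (∀ s : Rd d, ∀ x : Rd d, x ≠ 0 →
        Integrable (fun z : ((ℝ ∙ x)ᗮ : Submodule ℝ (Rd d)) =>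
          kinIntegrand d y s x (z : Rd d))) ∧
      (∀ s : Rd d,
        Integrable (fun x : Rd d => ‖x‖⁻¹ * hyperplaneIntegral d x (kinIntegrand d y s x))) ∧
      Continuous (Kwk d y) ∧
      wNorm d (r + 1) (Kwk d y) ≤ C * (wNorm d r y) ^ 3 := by
  have hr0 : 0 ≤ r := (Nat.cast_nonneg _).trans hr.le
  obtain ⟨L, hLm, hL⟩ := exists_hyperplane_frame (d := d) (by omega)
  obtain ⟨C, hC, hCs⟩ := exists_lintegral_rectWeight_le hd hr hLm hL
  refine ⟨2 * Real.pi * ((1 + 2 ^ r) * C), by positivity, fun y hy =>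
    ⟨fun s x _ => integrable_kinIntegrand_hyperplane hr hy s x, fun s => ?_,
      continuous_Kwk hd hr hLm hL hy, ciSup_le fun s => ?_⟩⟩
  · rw [funext (inv_norm_mul_hyperplaneIntegral_eq (by omega) hL (kinIntegrand d y s))]
    have h := integrable_kinIntegrand_frame hd hr hLm hL hy s
    rw [Measure.volume_eq_prod] at h
    exact h.integral_prod_left
  · set K := wNorm d r y with hKdef
    have hK : 0 ≤ K := wNorm_nonneg d r y
    have hN0 : ∀ p : Rd d × Rd (d - 1), 0 ≤ ‖p.1‖⁻¹ * rectWeight r s p.1 (L p.1 p.2) := fun p =>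
      mul_nonneg (by positivity) (rectWeight_nonneg _ _ _ _)
    have hN : ∫ p : Rd d × Rd (d - 1), ‖p.1‖⁻¹ * rectWeight r s p.1 (L p.1 p.2) ≤
        C * (1 + ‖s‖)⁻¹ := by
      rw [integral_eq_lintegral_of_nonneg_ae (Filter.Eventually.of_forall hN0)
        (measurable_rectWeight_frame hLm s).aestronglyMeasurable]
      exact ENNReal.toReal_le_of_le_ofReal (by positivity) (hCs s)
    have hg : |∫ p : Rd d × Rd (d - 1), ‖p.1‖⁻¹ * kinIntegrand d y s p.1 (L p.1 p.2)| ≤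
        K ^ 3 * (1 + 2 ^ r) * japWeight r s * (C * (1 + ‖s‖)⁻¹) := by
      refine (norm_integral_le_of_norm_le
        ((integrable_rectWeight_frame hd hr hLm hL s).const_mul _)
        (Filter.Eventually.of_forall (norm_kinIntegrand_frame_le hr0 hL hy s))).trans ?_
      rw [integral_const_mul]
      have := japWeight_nonneg r s
      gcongr
    have hpow : (1 + ‖s‖) ^ (r + 1) * (japWeight r s * (1 + ‖s‖)⁻¹) = 1 := by
      unfold japWeight
      rw [← Real.rpow_neg_one, ← Real.rpow_add (by positivity), ← Real.rpow_add (by positivity),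
        show r + 1 + (-r + -1) = 0 by ring, Real.rpow_zero]
    rw [Kwk_eq_integral_frame hd hr hLm hL hy s, abs_mul, abs_of_nonneg (by positivity)]
    calc (1 + ‖s‖) ^ (r + 1) * (2 * Real.pi *
          |∫ p : Rd d × Rd (d - 1), ‖p.1‖⁻¹ * kinIntegrand d y s p.1 (L p.1 p.2)|)
        ≤ (1 + ‖s‖) ^ (r + 1) * (2 * Real.pi *
          (K ^ 3 * (1 + 2 ^ r) * japWeight r s * (C * (1 + ‖s‖)⁻¹))) := by gcongr
      _ = 2 * Real.pi * ((1 + 2 ^ r) * C) * K ^ 3 *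
          ((1 + ‖s‖) ^ (r + 1) * (japWeight r s * (1 + ‖s‖)⁻¹)) := by ring
      _ = _ := by rw [hpow, mul_one]
end
end

section
/- Let d ≥ 2 and r > d. Then there exists a constant C > 0 such that for every R > 0 and all y, y' ∈ C_r(ℝ^d) with ‖y‖_r ≤ R and ‖y'‖_r ≤ R, one has ‖K(y) − K(y')‖_{r+1} ≤ C R² ‖y − y'‖_r; in particular the wave kinetic integral K : C_r(ℝ^d) → C_{r+1}(ℝ^d) is Lipschitz on bounded balls and hence continuous. -/
open MeasureTheory

noncomputable section

open Set Filter Topology Module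

/-- The decomposition `ℝ × e^⊥ → ℝ^d` along a unit vector `e` preserves Lebesgue measure. -/
lemma measurePreserving_smul_add_orthogonal {d : ℕ} {e : Rd d} (he : ‖e‖ = 1) :
    MeasurePreserving (fun p : ℝ × ((ℝ ∙ e)ᗮ : Submodule ℝ (Rd d)) => p.1 • e + (p.2 : Rd d))
      (volume.prod volume) volume := by
  have h1 := (LinearIsometryEquiv.toSpanUnitSingleton (𝕜 := ℝ) e he).measurePreserving
  have h2 := h1.prod (MeasurePreserving.id (volume : Measure ((ℝ ∙ e)ᗮ : Submodule ℝ (Rd d))))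
  have h3 := (ℝ ∙ e).orthogonalDecomposition.symm.measurePreserving.comp
    ((WithLp.volume_preserving_toLp (ℝ ∙ e) ((ℝ ∙ e)ᗮ : Submodule ℝ (Rd d))).comp h2)
  have h (p : ℝ × ((ℝ ∙ e)ᗮ : Submodule ℝ (Rd d))) : (ℝ ∙ e).orthogonalDecomposition.symm
      (WithLp.toLp 2 (Prod.map (LinearIsometryEquiv.toSpanUnitSingleton e he) id p)) =
        p.1 • e + (p.2 : Rd d) := by
    simp [Submodule.orthogonalDecomposition_symm_apply]
  simpa only [Function.comp_def, h] using h3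

lemma hyperplaneIntegral_smul {d : ℕ} {c : ℝ} (hc : c ≠ 0) (e : Rd d) (f : Rd d → ℝ) :
    hyperplaneIntegral d (c • e) f = hyperplaneIntegral d e f := by
  have h (p q : Submodule ℝ (Rd d)) (hpq : p = q) :
      ∫ z : (pᗮ : Submodule ℝ (Rd d)), f z = ∫ z : (qᗮ : Submodule ℝ (Rd d)), f z := by
    subst hpq
    rfl
  exact h _ _ (Submodule.span_singleton_smul_eq (IsUnit.mk0 c hc) e)

/-- Normalized indicator of the slab `|x·z| < δ`. -/
def slabKernel {d : ℕ} (δ : ℝ) (x z : Rd d) : ℝ :=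
  if |inner ℝ x z| < δ then (2 * δ)⁻¹ else 0

lemma slabKernel_comm {d : ℕ} (δ : ℝ) (x z : Rd d) : slabKernel δ x z = slabKernel δ z x := by
  simp only [slabKernel, real_inner_comm]

lemma slabKernel_nonneg {d : ℕ} {δ : ℝ} (hδ : 0 < δ) (x z : Rd d) : 0 ≤ slabKernel δ x z := by
  unfold slabKernel
  split_ifs <;> positivity

@[fun_prop]
lemma measurable_slabKernel {d : ℕ} (δ : ℝ) {α : Type*} [MeasurableSpace α] {f g : α → Rd d}
    (hf : Measurable f) (hg : Measurable g) : Measurable fun a => slabKernel δ (f a) (g a) :=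
  Measurable.ite (measurableSet_lt (by fun_prop) measurable_const) measurable_const measurable_const

lemma slabKernel_smul_add {d : ℕ} {e : Rd d} (he : ‖e‖ = 1) {c : ℝ} (hc : 0 < c) (δ t : ℝ)
    (z : ((ℝ ∙ e)ᗮ : Submodule ℝ (Rd d))) :
    slabKernel δ (c • e) (t • e + (z : Rd d)) =
      (Ioo (-(δ / c)) (δ / c)).indicator (fun _ => (2 * δ)⁻¹) t := by
  have hz : inner ℝ e (z : Rd d) = 0 := Submodule.mem_orthogonal_singleton_iff_inner_right.1 z.2
  have h : inner ℝ (c • e) (t • e + (z : Rd d)) = c * t := by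
    simp [inner_add_right, inner_smul_left, inner_smul_right, hz, he, mul_comm]
  have h' : |inner ℝ (c • e) (t • e + (z : Rd d))| < δ ↔ t ∈ Ioo (-(δ / c)) (δ / c) := by
    rw [h, abs_mul, abs_of_pos hc, mul_comm, ← lt_div_iff₀ hc, abs_lt, mem_Ioo]
  simp only [slabKernel, indicator, h']

/-- The weight `(1 + |u|)^{-r}` with values in `ℝ≥0∞`. -/
def eWeight (d : ℕ) (r : ℝ) (u : Rd d) : ENNReal := ENNReal.ofReal ((1 + ‖u‖) ^ (-r))

@[fun_prop]
lemma measurable_eWeight (d : ℕ) (r : ℝ) : Measurable (eWeight d r) := by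
  unfold eWeight
  fun_prop

lemma lintegral_hyperplane_weight_le {d : ℕ} {r : ℝ} (hr : 0 ≤ r) {e : Rd d} (he : ‖e‖ = 1)
    (u : Rd d) :
    ∫⁻ z : ((ℝ ∙ e)ᗮ : Submodule ℝ (Rd d)), eWeight d r (u + z) ≤
      ∫⁻ z : Rd (d - 1), eWeight (d - 1) r z := by
  set V : Submodule ℝ (Rd d) := (ℝ ∙ e)ᗮ
  have he0 : e ≠ 0 := by rintro rfl; simp at he
  have hdim : finrank ℝ V = d - 1 := by
    have h := (ℝ ∙ e).finrank_add_finrank_orthogonal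
    rw [finrank_span_singleton he0, finrank_euclideanSpace_fin] at h
    have : finrank ℝ V = finrank ℝ ((ℝ ∙ e)ᗮ : Submodule ℝ (Rd d)) := rfl
    omega
  let b := (stdOrthonormalBasis ℝ V).reindex (finCongr hdim)
  calc ∫⁻ z : V, eWeight d r (u + z)
      ≤ ∫⁻ z : V, ENNReal.ofReal ((1 + ‖V.orthogonalProjectionOnto u + z‖) ^ (-r)) := by
        refine lintegral_mono fun z => ENNReal.ofReal_le_ofReal ?_
        refine Real.rpow_le_rpow_of_nonpos (by positivity) ?_ (by linarith)
        have h := V.norm_orthogonalProjectionOnto_apply_le (u + z)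
        rw [map_add, Submodule.orthogonalProjectionOnto_mem_subspace_eq_self] at h
        linarith
    _ = ∫⁻ z : V, ENNReal.ofReal ((1 + ‖z‖) ^ (-r)) :=
        lintegral_add_left_eq_self (fun z : V => ENNReal.ofReal ((1 + ‖z‖) ^ (-r))) _
    _ = ∫⁻ z : V, eWeight (d - 1) r (b.repr z) := by simp [eWeight]
    _ = ∫⁻ z : Rd (d - 1), eWeight (d - 1) r z :=
        b.measurePreserving_repr.lintegral_comp (measurable_eWeight _ _)

lemma lintegral_slabKernel_mul_weight_le {d : ℕ} {r : ℝ} (hr : 0 ≤ r) {δ : ℝ} (hδ : 0 < δ)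
    {x : Rd d} (hx : x ≠ 0) (u : Rd d) :
    ∫⁻ z, ENNReal.ofReal (slabKernel δ x z) * eWeight d r (u + z) ≤
      ENNReal.ofReal ‖x‖⁻¹ * ∫⁻ z : Rd (d - 1), eWeight (d - 1) r z := by
  obtain ⟨c, e, hc, he, rfl⟩ : ∃ (c : ℝ) (e : Rd d), 0 < c ∧ ‖e‖ = 1 ∧ x = c • e :=
    ⟨‖x‖, ‖x‖⁻¹ • x, norm_pos_iff.2 hx, norm_smul_inv_norm hx,
      (smul_inv_smul₀ (norm_ne_zero_iff.2 hx) x).symm⟩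
  have hm : Measurable fun z => ENNReal.ofReal (slabKernel δ (c • e) z) * eWeight d r (u + z) := by
    fun_prop
  have hmp := measurePreserving_smul_add_orthogonal he
  have hm' := (hm.comp hmp.measurable).aemeasurable (μ := volume.prod volume)
  simp only [Function.comp_def] at hm'
  rw [← hmp.lintegral_comp hm, lintegral_prod _ hm']
  simp only [slabKernel_smul_add he hc]
  set C := ∫⁻ z : Rd (d - 1), eWeight (d - 1) r z
  calc _ ≤ ∫⁻ t : ℝ, (Ioo (-(δ / c)) (δ / c)).indicator
        (fun _ => ENNReal.ofReal (2 * δ)⁻¹ * C) t := by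
        refine lintegral_mono fun t => ?_
        by_cases ht : t ∈ Ioo (-(δ / c)) (δ / c)
        · simp only [indicator_of_mem ht]
          rw [lintegral_const_mul _ (by fun_prop)]
          simp_rw [← add_assoc]
          gcongr
          exact lintegral_hyperplane_weight_le hr he _
        · simp [indicator_of_notMem ht]
    _ = _ := by
        rw [lintegral_indicator_const measurableSet_Ioo, Real.volume_Ioo, mul_right_comm,
          ← ENNReal.ofReal_mul (by positivity), norm_smul, he, Real.norm_of_nonneg hc.le]
        congr 2
        field_simp
        ring

lemma tendsto_integral_slabKernel {d : ℕ} {r : ℝ} (hr : (d : ℝ) < r) {F : Rd d → ℝ}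
    (hF : Continuous F) {K : ℝ} (hK : ∀ z, |F z| ≤ K * (1 + ‖z‖) ^ (-r)) {x : Rd d} (hx : x ≠ 0) :
    Tendsto (fun δ => ∫ z, slabKernel δ x z * F z) (𝓝[>] 0)
      (𝓝 (‖x‖⁻¹ * hyperplaneIntegral d x F)) := by
  have hr0 : 0 < r := (Nat.cast_nonneg d).trans_lt hr
  have hK0 : 0 ≤ K := by
    have := (abs_nonneg _).trans (hK 0)
    simpa using this
  obtain ⟨c, e, hc, he, rfl⟩ : ∃ (c : ℝ) (e : Rd d), 0 < c ∧ ‖e‖ = 1 ∧ x = c • e :=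
    ⟨‖x‖, ‖x‖⁻¹ • x, norm_pos_iff.2 hx, norm_smul_inv_norm hx,
      (smul_inv_smul₀ (norm_ne_zero_iff.2 hx) x).symm⟩
  set V : Submodule ℝ (Rd d) := (ℝ ∙ e)ᗮ
  have hmp := measurePreserving_smul_add_orthogonal he
  have hFi : Integrable F := by
    have hw := integrable_one_add_norm (E := Rd d) (μ := volume) (r := r) (by simpa using hr)
    exact (hw.const_mul K).mono' hF.aestronglyMeasurable (ae_of_all _ hK)
  let G : ℝ → ℝ := fun t => ∫ z : V, F (t • e + (z : Rd d))
  have hG : Continuous G := by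
    refine continuous_of_dominated (bound := fun z : V => K * (1 + ‖z‖) ^ (-r))
      (fun t => (by fun_prop : Continuous _).aestronglyMeasurable)
      (fun t => ae_of_all _ fun z => ?_)
      (Integrable.const_mul (integrable_one_add_norm ?_) K) (ae_of_all _ fun z => by fun_prop)
    · refine (hK _).trans ?_
      gcongr ?_ * ?_
      refine Real.rpow_le_rpow_of_nonpos (by positivity) ?_ (by linarith)
      have h := V.norm_orthogonalProjectionOnto_apply_le (t • e + z)
      have h0 : V.orthogonalProjectionOnto (t • e) = 0 :=
        Submodule.orthogonalProjectionOnto_orthogonal_apply_eq_zero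
          (Submodule.smul_mem _ _ (Submodule.mem_span_singleton_self e))
      rw [map_add, Submodule.orthogonalProjectionOnto_mem_subspace_eq_self, h0, zero_add] at h
      linarith
    · have h1 : finrank ℝ V ≤ finrank ℝ (Rd d) := V.finrank_le
      rw [finrank_euclideanSpace_fin] at h1
      exact lt_of_le_of_lt (by exact_mod_cast h1) hr
  have key : ∀ δ > 0, ∫ z, slabKernel δ (c • e) z * F z =
      (2 * c)⁻¹ * ∫ t in (-1 : ℝ)..1, G (δ / c * t) := by
    intro δ hδ
    have hint : Integrable (fun z => slabKernel δ (c • e) z * F z) := by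
      refine hFi.bdd_mul (c := (2 * δ)⁻¹) (by fun_prop : Measurable _).aestronglyMeasurable
        (ae_of_all _ fun z => ?_)
      rw [Real.norm_of_nonneg (slabKernel_nonneg hδ _ _)]
      unfold slabKernel
      split_ifs
      · exact le_rfl
      · positivity
    have hint2 := (hmp.integrable_comp hint.aestronglyMeasurable).2 hint
    simp only [Function.comp_def] at hint2
    have hδc : 0 < δ / c := by positivity
    rw [← hmp.map_eq, integral_map hmp.measurable.aemeasurable
        (by rw [hmp.map_eq]; exact hint.aestronglyMeasurable), integral_prod _ hint2]
    simp only [slabKernel_smul_add he hc, integral_const_mul]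
    rw [intervalIntegral.integral_comp_mul_left _ hδc.ne', mul_one, mul_neg_one,
      intervalIntegral.integral_of_le (by linarith), integral_Ioc_eq_integral_Ioo,
      ← integral_indicator measurableSet_Ioo, smul_eq_mul, ← mul_assoc, ← integral_const_mul]
    congr 1 with t
    by_cases ht : t ∈ Ioo (-(δ / c)) (δ / c)
    · simp only [indicator_of_mem ht, G]
      field_simp
      rfl
    · simp [indicator_of_notMem ht]
  have hI : Continuous fun δ => (2 * c)⁻¹ * ∫ t in (-1 : ℝ)..1, G (δ / c * t) :=
    (intervalIntegral.continuous_parametric_intervalIntegral_of_continuous'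
      (by fun_prop) (-1) 1).const_mul _
  have hlim := (hI.tendsto 0).mono_left (nhdsWithin_le_nhds (s := Ioi 0))
  have hval : ‖c • e‖⁻¹ * hyperplaneIntegral d (c • e) F =
      (2 * c)⁻¹ * ∫ t in (-1 : ℝ)..1, G (0 / c * t) := by
    have hG0 : hyperplaneIntegral d e F = G 0 := by simp [hyperplaneIntegral, G, V]
    rw [hyperplaneIntegral_smul hc.ne', norm_smul, he, Real.norm_of_nonneg hc.le, hG0]
    simp
    ring
  rw [hval]
  refine hlim.congr' ?_
  filter_upwards [self_mem_nhdsWithin] with δ hδ using (key δ hδ).symm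

lemma lintegral_weight_lt_top {d : ℕ} {r : ℝ} (hr : (d : ℝ) < r) :
    ∫⁻ z : Rd d, eWeight d r z < ⊤ :=
  finite_integral_one_add_norm (by simpa using hr)

lemma integrable_inv_norm_mul_rpow {d : ℕ} (hd : 2 ≤ d) {r : ℝ} (hr : (d : ℝ) < r) :
    Integrable (fun x : Rd d => ‖x‖⁻¹ * (1 + ‖x‖) ^ (1 - r)) := by
  have : Nontrivial (Rd d) := nontrivial_of_finrank_pos (R := ℝ) (by simp; omega)
  rw [integrable_fun_norm_addHaar volume (f := fun t : ℝ => t⁻¹ * (1 + t) ^ (1 - r)),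
    finrank_euclideanSpace_fin]
  have h := integrable_one_add_norm (E := ℝ) (μ := volume) (r := r + 1 - d) (by simp; linarith)
  refine (h.integrableOn (s := Ioi 0)).mono' (by fun_prop) ?_
  filter_upwards [ae_restrict_mem measurableSet_Ioi] with t ht
  have ht0 : 0 < t := ht
  obtain ⟨k, rfl⟩ := Nat.exists_eq_add_of_le' hd
  have h1 : t ^ (k + 2 - 1) • (t⁻¹ * (1 + t) ^ (1 - r)) = t ^ k * (1 + t) ^ (1 - r) := by
    rw [show k + 2 - 1 = k + 1 by omega, smul_eq_mul, pow_succ]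
    field_simp
  have h2 : (1 + ‖t‖) ^ (-(r + 1 - ((k + 2 : ℕ) : ℝ))) = (1 + t) ^ k * (1 + t) ^ (1 - r) := by
    rw [Real.norm_of_nonneg ht0.le, ← Real.rpow_natCast, ← Real.rpow_add (by positivity)]
    congr 1
    push_cast
    ring
  rw [h1, h2, Real.norm_of_nonneg (by positivity)]
  gcongr
  linarith

lemma inv_norm_mul_weight_le {d : ℕ} {r : ℝ} (hr : 1 ≤ r) (u x : Rd d) :
    ‖x‖⁻¹ * (1 + ‖u + x‖) ^ (-r) ≤
      (1 + ‖u‖)⁻¹ * (4 * (1 + ‖u + x‖) ^ (-r) + 2 ^ r * (‖x‖⁻¹ * (1 + ‖x‖) ^ (1 - r))) := by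
  rcases le_or_gt ((1 + ‖u‖) / 4) ‖x‖ with h | h
  · have h1 : ‖x‖⁻¹ ≤ (1 + ‖u‖)⁻¹ * 4 := by
      refine (inv_anti₀ (by positivity) h).trans_eq ?_
      field_simp
    calc ‖x‖⁻¹ * (1 + ‖u + x‖) ^ (-r) ≤ ((1 + ‖u‖)⁻¹ * 4) * (1 + ‖u + x‖) ^ (-r) := by gcongr
      _ = (1 + ‖u‖)⁻¹ * (4 * (1 + ‖u + x‖) ^ (-r)) := by ring
      _ ≤ _ := by
        gcongr
        exact le_add_of_nonneg_right (by positivity)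
  · have htri : ‖u‖ ≤ ‖u + x‖ + ‖x‖ := by simpa using norm_sub_le (u + x) x
    have h1 : (1 + ‖u‖) * (1 + ‖u + x‖) ^ (-r) ≤ 2 ^ r * (1 + ‖x‖) ^ (1 - r) := by
      calc (1 + ‖u‖) * (1 + ‖u + x‖) ^ (-r)
          ≤ (2 * (1 + ‖u + x‖)) * (1 + ‖u + x‖) ^ (-r) := by
            gcongr
            linarith [norm_nonneg (u + x)]
        _ = 2 * (1 + ‖u + x‖) ^ (1 - r) := by
            rw [sub_eq_add_neg, Real.rpow_add (by positivity), Real.rpow_one]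
            ring
        _ ≤ 2 * ((1 + ‖x‖) / 2) ^ (1 - r) := by
            gcongr 2 * ?_
            refine Real.rpow_le_rpow_of_nonpos (by positivity) ?_ (by linarith)
            linarith [norm_nonneg (u + x)]
        _ = 2 ^ r * (1 + ‖x‖) ^ (1 - r) := by
            have h2 : (2 : ℝ) = 2 ^ r * 2 ^ (1 - r) := by
              rw [← Real.rpow_add two_pos, add_sub_cancel, Real.rpow_one]
            rw [Real.div_rpow (by positivity) (by positivity)]
            nth_rewrite 1 [h2]
            field_simp
    calc ‖x‖⁻¹ * (1 + ‖u + x‖) ^ (-r)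
        = (1 + ‖u‖)⁻¹ * (‖x‖⁻¹ * ((1 + ‖u‖) * (1 + ‖u + x‖) ^ (-r))) := by field_simp
      _ ≤ (1 + ‖u‖)⁻¹ * (‖x‖⁻¹ * (2 ^ r * (1 + ‖x‖) ^ (1 - r))) := by gcongr
      _ = (1 + ‖u‖)⁻¹ * (2 ^ r * (‖x‖⁻¹ * (1 + ‖x‖) ^ (1 - r))) := by ring
      _ ≤ _ := by
        gcongr
        exact le_add_of_nonneg_left (by positivity)

lemma exists_lintegral_inv_norm_mul_weight_le {d : ℕ} (hd : 2 ≤ d) {r : ℝ} (hr : (d : ℝ) < r) :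
    ∃ C : ENNReal, C < ⊤ ∧ ∀ u : Rd d,
      ∫⁻ x, ENNReal.ofReal ‖x‖⁻¹ * eWeight d r (u + x) ≤ ENNReal.ofReal (1 + ‖u‖)⁻¹ * C := by
  have hr1 : 1 ≤ r := by
    have : (2 : ℝ) ≤ d := by exact_mod_cast hd
    linarith
  have hi := (integrable_inv_norm_mul_rpow hd hr).lintegral_lt_top
  refine ⟨ENNReal.ofReal 4 * (∫⁻ x : Rd d, eWeight d r x) +
    ENNReal.ofReal (2 ^ r) * ∫⁻ x : Rd d, ENNReal.ofReal (‖x‖⁻¹ * (1 + ‖x‖) ^ (1 - r)),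
    ENNReal.add_lt_top.2 ⟨ENNReal.mul_lt_top ENNReal.ofReal_lt_top (lintegral_weight_lt_top hr),
      ENNReal.mul_lt_top ENNReal.ofReal_lt_top hi⟩, fun u => ?_⟩
  calc ∫⁻ x, ENNReal.ofReal ‖x‖⁻¹ * eWeight d r (u + x)
      ≤ ∫⁻ x, ENNReal.ofReal (1 + ‖u‖)⁻¹ * (ENNReal.ofReal 4 * eWeight d r (u + x) +
          ENNReal.ofReal (2 ^ r) * ENNReal.ofReal (‖x‖⁻¹ * (1 + ‖x‖) ^ (1 - r))) := by
        refine lintegral_mono fun x => ?_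
        unfold eWeight
        rw [← ENNReal.ofReal_mul (by positivity), ← ENNReal.ofReal_mul (by positivity),
          ← ENNReal.ofReal_mul (by positivity),
          ← ENNReal.ofReal_add (by positivity) (by positivity),
          ← ENNReal.ofReal_mul (by positivity)]
        exact ENNReal.ofReal_le_ofReal (inv_norm_mul_weight_le hr1 u x)
    _ = _ := by
        rw [lintegral_const_mul _ (by fun_prop), lintegral_add_left (by fun_prop),
          lintegral_const_mul _ (by fun_prop), lintegral_const_mul _ (by fun_prop),
          lintegral_add_left_eq_self]

/-- The sum of the three pairwise products of weights at `s + x`, `s + z`, `s + x + z`. -/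
def pairWeight (d : ℕ) (r : ℝ) (s x z : Rd d) : ENNReal :=
  eWeight d r (s + x) * eWeight d r (s + z) + eWeight d r (s + x) * eWeight d r (s + x + z) +
    eWeight d r (s + z) * eWeight d r (s + x + z)

lemma exists_lintegral_slabKernel_mul_pairWeight_le {d : ℕ} (hd : 2 ≤ d) {r : ℝ}
    (hr : (d : ℝ) < r) :
    ∃ C : ENNReal, C < ⊤ ∧ ∀ s : Rd d, ∀ δ : ℝ, 0 < δ →
      ∫⁻ x, ∫⁻ z, ENNReal.ofReal (slabKernel δ x z) * pairWeight d r s x z ≤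
        ENNReal.ofReal (1 + ‖s‖)⁻¹ * C := by
  have hr0 : 0 ≤ r := (Nat.cast_nonneg d).trans hr.le
  have : Nontrivial (Rd d) := nontrivial_of_finrank_pos (R := ℝ) (by simp; omega)
  obtain ⟨C₁, hC₁, h₁⟩ := exists_lintegral_inv_norm_mul_weight_le hd hr
  set C₀ := ∫⁻ z : Rd (d - 1), eWeight (d - 1) r z
  have hC₀ : C₀ < ⊤ := by
    have h : ((d - 1 : ℕ) : ℝ) ≤ d := by exact_mod_cast d.sub_le 1
    exact lintegral_weight_lt_top (h.trans_lt hr)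
  refine ⟨3 * (C₁ * C₀), ENNReal.mul_lt_top ENNReal.ofNat_lt_top (ENNReal.mul_lt_top hC₁ hC₀),
    fun s δ hδ => ?_⟩
  have main (u : Rd d → Rd d) :
      ∫⁻ x, ∫⁻ z, ENNReal.ofReal (slabKernel δ x z) *
        (eWeight d r (s + x) * eWeight d r (u x + z)) ≤ ENNReal.ofReal (1 + ‖s‖)⁻¹ * (C₁ * C₀) := by
    calc _ ≤ ∫⁻ x, ENNReal.ofReal ‖x‖⁻¹ * eWeight d r (s + x) * C₀ := by
          refine lintegral_mono_ae ?_
          filter_upwards [compl_mem_ae_iff.2 (measure_singleton (μ := volume) (0 : Rd d))] with x hx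
          simp only [mul_left_comm _ (eWeight d r (s + x))]
          rw [lintegral_const_mul _ (by fun_prop), mul_right_comm, mul_comm]
          gcongr
          exact lintegral_slabKernel_mul_weight_le hr0 hδ hx _
      _ = (∫⁻ x, ENNReal.ofReal ‖x‖⁻¹ * eWeight d r (s + x)) * C₀ :=
          lintegral_mul_const _ (by fun_prop)
      _ ≤ ENNReal.ofReal (1 + ‖s‖)⁻¹ * C₁ * C₀ := by
          gcongr
          exact h₁ s
      _ = _ := mul_assoc _ _ _
  have hsplit (x : Rd d) : ∫⁻ z, ENNReal.ofReal (slabKernel δ x z) * pairWeight d r s x z =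
      (∫⁻ z, ENNReal.ofReal (slabKernel δ x z) * (eWeight d r (s + x) * eWeight d r (s + z))) +
      (∫⁻ z, ENNReal.ofReal (slabKernel δ x z) * (eWeight d r (s + x) * eWeight d r (s + x + z))) +
      ∫⁻ z, ENNReal.ofReal (slabKernel δ x z) *
        (eWeight d r (s + z) * eWeight d r (s + x + z)) := by
    simp only [pairWeight, mul_add]
    rw [lintegral_add_left (by fun_prop), lintegral_add_left (by fun_prop)]
  have hswap : ∫⁻ x, ∫⁻ z, ENNReal.ofReal (slabKernel δ x z) *
        (eWeight d r (s + z) * eWeight d r (s + x + z)) ≤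
          ENNReal.ofReal (1 + ‖s‖)⁻¹ * (C₁ * C₀) := by
    rw [lintegral_lintegral_swap (by fun_prop)]
    refine le_trans (le_of_eq ?_) (main fun z => s + z)
    simp only [slabKernel_comm, add_right_comm]
  simp only [hsplit]
  have hm (p q : Rd d × Rd d → Rd d) (hp : Measurable p) (hq : Measurable q) :
      Measurable fun x => ∫⁻ z, ENNReal.ofReal (slabKernel δ x z) *
        (eWeight d r (p (x, z)) * eWeight d r (q (x, z))) :=
    Measurable.lintegral_prod_right' (f := fun y : Rd d × Rd d =>
      ENNReal.ofReal (slabKernel δ y.1 y.2) * (eWeight d r (p y) * eWeight d r (q y)))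
      (by fun_prop)
  have hm1 := hm (fun y => s + y.1) (fun y => s + y.2) (by fun_prop) (by fun_prop)
  have hm2 := hm (fun y => s + y.1) (fun y => s + y.1 + y.2) (by fun_prop) (by fun_prop)
  simp only at hm1 hm2
  rw [lintegral_add_left (by fun_prop), lintegral_add_left hm1]
  refine (add_le_add (add_le_add (main fun _ => s) (main fun x => s + x)) hswap).trans_eq ?_
  ring

lemma integrable_inv_norm_mul_hyperplaneIntegral {d : ℕ} (hd : 2 ≤ d) {r : ℝ} (hr : (d : ℝ) < r)
    {F : Rd d → Rd d → ℝ} (hF : Continuous (Function.uncurry F))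
    (hdecay : ∀ x, ∃ K, ∀ z, |F x z| ≤ K * (1 + ‖z‖) ^ (-r)) {B : ENNReal} (hB : B < ⊤)
    (hFB : ∀ δ, 0 < δ → δ ≤ 1 → ∫⁻ x, ∫⁻ z, ENNReal.ofReal (slabKernel δ x z) * ‖F x z‖ₑ ≤ B) :
    Integrable (fun x => ‖x‖⁻¹ * hyperplaneIntegral d x (F x)) ∧
      ‖∫ x, ‖x‖⁻¹ * hyperplaneIntegral d x (F x)‖ₑ ≤ B := by
  have : Nontrivial (Rd d) := nontrivial_of_finrank_pos (R := ℝ) (by simp; omega)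
  let δ : ℕ → ℝ := fun n => 1 / ((n : ℝ) + 1)
  have hδ0 (n : ℕ) : 0 < δ n := Nat.one_div_pos_of_nat
  have hδ1 (n : ℕ) : δ n ≤ 1 := by
    have := Nat.one_div_le_one_div (α := ℝ) (Nat.zero_le n)
    simpa [δ] using this
  have hδ : Tendsto δ atTop (𝓝[>] 0) :=
    tendsto_nhdsWithin_iff.2 ⟨tendsto_one_div_add_atTop_nhds_zero_nat,
      Eventually.of_forall hδ0⟩
  let g : ℕ → Rd d → ℝ := fun n x => ∫ z, slabKernel (δ n) x z * F x z
  have hFm : Measurable fun p : Rd d × Rd d => F p.1 p.2 := hF.measurable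
  have hg (n : ℕ) : StronglyMeasurable (g n) :=
    StronglyMeasurable.integral_prod_right
      (f := fun x z => slabKernel (δ n) x z * F x z)
      (by fun_prop : Measurable fun p : Rd d × Rd d => _).stronglyMeasurable
  have hlim : ∀ᵐ x, Tendsto (fun n => g n x) atTop
      (𝓝 (‖x‖⁻¹ * hyperplaneIntegral d x (F x))) := by
    filter_upwards [compl_mem_ae_iff.2 (measure_singleton (μ := volume) (0 : Rd d))] with x hx
    obtain ⟨K, hK⟩ := hdecay x
    exact (tendsto_integral_slabKernel hr (by fun_prop) hK hx).comp hδ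
  have hgB (n : ℕ) : ∫⁻ x, ‖g n x‖ₑ ≤ B := by
    refine le_trans (lintegral_mono fun x => ?_) (hFB (δ n) (hδ0 n) (hδ1 n))
    refine (enorm_integral_le_lintegral_enorm _).trans_eq ?_
    simp only [enorm_mul, Real.enorm_of_nonneg (slabKernel_nonneg (hδ0 n) _ _)]
  have hbound : ∫⁻ x, ‖‖x‖⁻¹ * hyperplaneIntegral d x (F x)‖ₑ ≤ B := by
    calc _ = ∫⁻ x, liminf (fun n => ‖g n x‖ₑ) atTop := by
          refine lintegral_congr_ae ?_
          filter_upwards [hlim] with x hx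
          exact hx.enorm.liminf_eq.symm
      _ ≤ liminf (fun n => ∫⁻ x, ‖g n x‖ₑ) atTop :=
          lintegral_liminf_le fun n => (hg n).measurable.enorm
      _ ≤ B := liminf_le_of_le (by isBoundedDefault) fun b hb => by
          obtain ⟨n, hn⟩ := hb.exists
          exact hn.trans (hgB n)
  exact ⟨⟨aestronglyMeasurable_of_tendsto_ae atTop (fun n => (hg n).aestronglyMeasurable) hlim,
    hbound.trans_lt hB⟩, (enorm_integral_le_lintegral_enorm _).trans hbound⟩

lemma hyperplaneIntegral_sub {d : ℕ} {r : ℝ} (hr : (d : ℝ) < r) (x : Rd d) {f g : Rd d → ℝ}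
    (hf : Continuous f) (hg : Continuous g) (hfd : ∃ K, ∀ z, |f z| ≤ K * (1 + ‖z‖) ^ (-r))
    (hgd : ∃ K, ∀ z, |g z| ≤ K * (1 + ‖z‖) ^ (-r)) :
    hyperplaneIntegral d x (fun z => f z - g z) =
      hyperplaneIntegral d x f - hyperplaneIntegral d x g := by
  set V : Submodule ℝ (Rd d) := (ℝ ∙ x)ᗮ
  have hdim : (finrank ℝ V : ℝ) < r := by
    have h1 : finrank ℝ V ≤ finrank ℝ (Rd d) := V.finrank_le
    rw [finrank_euclideanSpace_fin] at h1
    exact lt_of_le_of_lt (by exact_mod_cast h1) hr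
  have key (f : Rd d → ℝ) (hf : Continuous f) (hfd : ∃ K, ∀ z, |f z| ≤ K * (1 + ‖z‖) ^ (-r)) :
      Integrable fun z : V => f z := by
    obtain ⟨K, hK⟩ := hfd
    exact ((integrable_one_add_norm hdim).const_mul K).mono'
      (by fun_prop : Continuous _).aestronglyMeasurable (ae_of_all _ fun z => hK z)
  exact integral_sub (key f hf hfd) (key g hg hgd)

lemma rpow_neg_le_of_le_mul {r a b c : ℝ} (hr : 0 ≤ r) (ha : 0 < a) (hb : 0 < b) (hc : 0 < c)
    (h : a ≤ c * b) : b ^ (-r) ≤ c ^ r * a ^ (-r) := by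
  calc b ^ (-r) = c ^ r * (c * b) ^ (-r) := by
        rw [Real.mul_rpow hc.le hb.le, ← mul_assoc, ← Real.rpow_add hc, add_neg_cancel,
          Real.rpow_zero, one_mul]
    _ ≤ c ^ r * a ^ (-r) := by
        gcongr ?_ * ?_
        exact Real.rpow_le_rpow_of_nonpos ha h (by linarith)

/-- On the approximate resonant set, one of `s + x`, `s + z` has size comparable to `s`. -/
lemma weight_mul_weight_le {d : ℕ} {r : ℝ} (hr : 0 ≤ r) {s x z : Rd d} (h : |inner ℝ x z| ≤ 1) :
    (1 + ‖s + x‖) ^ (-r) * (1 + ‖s + z‖) ^ (-r) ≤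
      3 ^ r * (1 + ‖s‖) ^ (-r) * ((1 + ‖s + x‖) ^ (-r) + (1 + ‖s + z‖) ^ (-r)) := by
  have hsq : ‖s‖ ^ 2 ≤ ‖s + x‖ ^ 2 + ‖s + z‖ ^ 2 + 2 := by
    have h1 : ‖s‖ ^ 2 + ‖s + x + z‖ ^ 2 = ‖s + x‖ ^ 2 + ‖s + z‖ ^ 2 + 2 * inner ℝ x z := by
      simp only [norm_add_sq_real, inner_add_left]
      ring
    nlinarith [sq_nonneg ‖s + x + z‖, (abs_le.1 h).2]
  have hA : 0 ≤ (1 + ‖s + x‖) ^ (-r) := by positivity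
  have hB : 0 ≤ (1 + ‖s + z‖) ^ (-r) := by positivity
  have hS : 0 ≤ 3 ^ r * (1 + ‖s‖) ^ (-r) := by positivity
  rcases le_total ‖s + x‖ ‖s + z‖ with hle | hle
  · have h3 : (1 + ‖s + z‖) ^ (-r) ≤ 3 ^ r * (1 + ‖s‖) ^ (-r) :=
      rpow_neg_le_of_le_mul hr (by positivity) (by positivity) three_pos
        (by nlinarith [norm_nonneg (s + x), norm_nonneg s])
    nlinarith [mul_le_mul_of_nonneg_left h3 hA, mul_nonneg hS hB]
  · have h3 : (1 + ‖s + x‖) ^ (-r) ≤ 3 ^ r * (1 + ‖s‖) ^ (-r) :=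
      rpow_neg_le_of_le_mul hr (by positivity) (by positivity) three_pos
        (by nlinarith [norm_nonneg (s + z), norm_nonneg s])
    nlinarith [mul_le_mul_of_nonneg_left h3 hB, mul_nonneg hS hA]

lemma abs_mul_mul_sub_le {R N A B C a b c a' b' c' : ℝ}
    (ha : |a - a'| ≤ N * A) (hb : |b - b'| ≤ N * B) (hc : |c - c'| ≤ N * C)
    (hb1 : |b| ≤ R * B) (hc1 : |c| ≤ R * C) (ha2 : |a'| ≤ R * A) (hb2 : |b'| ≤ R * B) :
    |a * b * c - a' * b' * c'| ≤ 3 * R ^ 2 * N * (A * B * C) := by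
  have e : a * b * c - a' * b' * c' =
      (a - a') * b * c + a' * (b - b') * c + a' * b' * (c - c') := by ring
  have p1 : 0 ≤ N * A := (abs_nonneg _).trans ha
  have p2 : 0 ≤ R * A := (abs_nonneg _).trans ha2
  have p3 : 0 ≤ R * B := (abs_nonneg _).trans hb1
  have p4 : 0 ≤ N * B := (abs_nonneg _).trans hb
  rw [e]
  calc _ ≤ |a - a'| * |b| * |c| + |a'| * |b - b'| * |c| + |a'| * |b'| * |c - c'| := by
        simpa only [abs_mul] using abs_add_three ((a - a') * b * c) (a' * (b - b') * c)
          (a' * b' * (c - c'))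
    _ ≤ (N * A) * (R * B) * (R * C) + (R * A) * (N * B) * (R * C) +
          (R * A) * (R * B) * (N * C) := by gcongr
    _ = _ := by ring

lemma abs_kinIntegrand_sub_le {d : ℕ} {r : ℝ} (hr : 0 ≤ r) {R N : ℝ} {y y' : Rd d → ℝ}
    (hy : ∀ u, |y u| ≤ R * (1 + ‖u‖) ^ (-r)) (hy' : ∀ u, |y' u| ≤ R * (1 + ‖u‖) ^ (-r))
    (hN : ∀ u, |y u - y' u| ≤ N * (1 + ‖u‖) ^ (-r)) {s x z : Rd d} (h : |inner ℝ x z| ≤ 1) :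
    |kinIntegrand d y s x z - kinIntegrand d y' s x z| ≤
      3 * (3 ^ r + 1) * R ^ 2 * N * (1 + ‖s‖) ^ (-r) *
        ((1 + ‖s + x‖) ^ (-r) * (1 + ‖s + z‖) ^ (-r) +
          (1 + ‖s + x‖) ^ (-r) * (1 + ‖s + x + z‖) ^ (-r) +
          (1 + ‖s + z‖) ^ (-r) * (1 + ‖s + x + z‖) ^ (-r)) := by
  have hN0 : 0 ≤ N := by simpa using (abs_nonneg _).trans (hN 0)
  have hw := weight_mul_weight_le hr (s := s) h
  have t (u v w : Rd d) := abs_mul_mul_sub_le (hN u) (hN v) (hN w) (hy v) (hy w) (hy' u) (hy' v)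
  have t1 := t (s + x) (s + z) (s + x + z)
  have t2 := t (s + x) (s + z) s
  have t3 := t (s + z) (s + x + z) s
  have t4 := t (s + x) (s + x + z) s
  clear t
  have hS : 0 ≤ (1 + ‖s‖) ^ (-r) := by positivity
  have hA : 0 ≤ (1 + ‖s + x‖) ^ (-r) := by positivity
  have hB : 0 ≤ (1 + ‖s + z‖) ^ (-r) := by positivity
  have hD : 0 ≤ (1 + ‖s + x + z‖) ^ (-r) := by positivity
  have h3 : (0 : ℝ) ≤ 3 ^ r := by positivity
  generalize (1 + ‖s‖) ^ (-r) = S at *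
  generalize (1 + ‖s + x‖) ^ (-r) = A at *
  generalize (1 + ‖s + z‖) ^ (-r) = B at *
  generalize (1 + ‖s + x + z‖) ^ (-r) = D at *
  generalize (3 : ℝ) ^ r = c at *
  have hABD : A * B * D ≤ c * S * (A * D + B * D) := by
    calc A * B * D ≤ (c * S * (A + B)) * D := by gcongr
      _ = _ := by ring
  set M := 3 * R ^ 2 * N with hM
  have hM0 : 0 ≤ M := by positivity
  have hcAB : 0 ≤ M * (c * S * (A * B)) := by positivity
  have e : kinIntegrand d y s x z - kinIntegrand d y' s x z =
      (y (s + x) * y (s + z) * y (s + x + z) - y' (s + x) * y' (s + z) * y' (s + x + z)) +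
      (y (s + x) * y (s + z) * y s - y' (s + x) * y' (s + z) * y' s) -
      (y (s + z) * y (s + x + z) * y s - y' (s + z) * y' (s + x + z) * y' s) -
      (y (s + x) * y (s + x + z) * y s - y' (s + x) * y' (s + x + z) * y' s) := by
    simp only [kinIntegrand]
    ring
  calc |kinIntegrand d y s x z - kinIntegrand d y' s x z|
      ≤ M * (A * B * D) + M * (A * B * S) + M * (B * D * S) + M * (A * D * S) := by
        rw [e, abs_le]
        rw [abs_le] at t1 t2 t3 t4
        constructor <;> linarith
    _ ≤ M * (c * S * (A * D + B * D)) + M * (A * B * S) + M * (B * D * S) + M * (A * D * S) := by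
        gcongr
    _ ≤ M * (c * S * (A * D + B * D)) + M * (A * B * S) + M * (B * D * S) + M * (A * D * S) +
        M * (c * S * (A * B)) := le_add_of_nonneg_right hcAB
    _ = _ := by
        rw [hM]
        ring

lemma exists_abs_kinIntegrand_le {d : ℕ} {r : ℝ} (hr : 0 ≤ r) {R : ℝ} {y : Rd d → ℝ}
    (hy : ∀ u, |y u| ≤ R * (1 + ‖u‖) ^ (-r)) (s x : Rd d) :
    ∃ K, ∀ z, |kinIntegrand d y s x z| ≤ K * (1 + ‖z‖) ^ (-r) := by
  have hR : 0 ≤ R := by simpa using (abs_nonneg _).trans (hy 0)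
  have hyR (u : Rd d) : |y u| ≤ R := (hy u).trans <| mul_le_of_le_one_right hR <|
    Real.rpow_le_one_of_one_le_of_nonpos (by linarith [norm_nonneg u]) (by linarith)
  have hshift (u z : Rd d) : |y (u + z)| ≤ R * (1 + ‖u‖) ^ r * (1 + ‖z‖) ^ (-r) := by
    rw [mul_assoc]
    refine (hy _).trans ?_
    gcongr
    refine rpow_neg_le_of_le_mul hr (by positivity) (by positivity) (by positivity) ?_
    have h : ‖z‖ ≤ ‖u + z‖ + ‖u‖ := by simpa using norm_sub_le (u + z) u
    nlinarith [norm_nonneg u, norm_nonneg (u + z)]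
  refine ⟨3 * (R ^ 2 * (R * (1 + ‖s‖) ^ r)) + R ^ 2 * (R * (1 + ‖s + x‖) ^ r), fun z => ?_⟩
  have h3 {a b c : ℝ} (ha : |a| ≤ R) (hb : |b| ≤ R) {M : ℝ} (hc : |c| ≤ M) :
      |a * b * c| ≤ R ^ 2 * M := by
    rw [abs_mul, abs_mul, sq]
    gcongr
  have t1 := h3 (hyR (s + x)) (hyR (s + x + z)) (hshift s z)
  have t2 := h3 (hyR (s + x)) (hyR s) (hshift s z)
  have t3 := h3 (hyR (s + x + z)) (hyR s) (hshift s z)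
  have t4 := h3 (hyR (s + x)) (hyR s) (hshift (s + x) z)
  rw [abs_le] at t1 t2 t3 t4 ⊢
  unfold kinIntegrand
  constructor <;> linarith

lemma continuous_kinIntegrand_s6 {d : ℕ} {y : Rd d → ℝ} (hy : Continuous y) (s : Rd d) :
    Continuous (Function.uncurry (kinIntegrand d y s)) := by
  unfold kinIntegrand Function.uncurry
  fun_prop

lemma exists_kinIntegrand_sub_bound {d : ℕ} (hd : 2 ≤ d) {r : ℝ} (hr : (d : ℝ) < r) :
    ∃ C : ℝ, 0 ≤ C ∧ ∀ (R N : ℝ) (y y' : Rd d → ℝ), Continuous y → Continuous y' →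
      (∀ u, |y u| ≤ R * (1 + ‖u‖) ^ (-r)) → (∀ u, |y' u| ≤ R * (1 + ‖u‖) ^ (-r)) →
      (∀ u, |y u - y' u| ≤ N * (1 + ‖u‖) ^ (-r)) → ∀ s,
      let F := fun x z => kinIntegrand d y s x z - kinIntegrand d y' s x z
      Integrable (fun x => ‖x‖⁻¹ * hyperplaneIntegral d x (F x)) ∧
        |∫ x, ‖x‖⁻¹ * hyperplaneIntegral d x (F x)| ≤
          C * R ^ 2 * N * (1 + ‖s‖) ^ (-(r + 1)) := by
  have hr0 : 0 ≤ r := (Nat.cast_nonneg d).trans hr.le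
  obtain ⟨C, hC, hCb⟩ := exists_lintegral_slabKernel_mul_pairWeight_le hd hr
  refine ⟨3 * (3 ^ r + 1) * C.toReal, by positivity, fun R N y y' hyc hyc' hy hy' hN s => ?_⟩
  intro F
  have hN0 : 0 ≤ N := by simpa using (abs_nonneg _).trans (hN 0)
  set M := 3 * (3 ^ r + 1) * R ^ 2 * N * (1 + ‖s‖) ^ (-r) with hM
  have hM0 : 0 ≤ M := by positivity
  have hFc : Continuous (Function.uncurry F) :=
    (continuous_kinIntegrand_s6 hyc s).sub (continuous_kinIntegrand_s6 hyc' s)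
  have hFd (x : Rd d) : ∃ K, ∀ z, |F x z| ≤ K * (1 + ‖z‖) ^ (-r) := by
    obtain ⟨K, hK⟩ := exists_abs_kinIntegrand_le hr0 hy s x
    obtain ⟨K', hK'⟩ := exists_abs_kinIntegrand_le hr0 hy' s x
    refine ⟨K + K', fun z => (abs_sub _ _).trans ?_⟩
    rw [add_mul]
    exact add_le_add (hK z) (hK' z)
  have hpt (δ : ℝ) (hδ1 : δ ≤ 1) (x z : Rd d) : ENNReal.ofReal (slabKernel δ x z) * ‖F x z‖ₑ ≤
      ENNReal.ofReal M * (ENNReal.ofReal (slabKernel δ x z) * pairWeight d r s x z) := by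
    by_cases hxz : |inner ℝ x z| < δ
    · rw [mul_left_comm]
      gcongr
      unfold pairWeight eWeight
      rw [← ENNReal.ofReal_mul (by positivity), ← ENNReal.ofReal_mul (by positivity),
        ← ENNReal.ofReal_mul (by positivity), ← ENNReal.ofReal_add (by positivity) (by positivity),
        ← ENNReal.ofReal_add (by positivity) (by positivity), ← ENNReal.ofReal_mul hM0,
        Real.enorm_eq_ofReal_abs]
      exact ENNReal.ofReal_le_ofReal (abs_kinIntegrand_sub_le hr0 hy hy' hN (hxz.le.trans hδ1))
    · simp [slabKernel, hxz]
  have hB : ENNReal.ofReal M * (ENNReal.ofReal (1 + ‖s‖)⁻¹ * C) < ⊤ :=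
    ENNReal.mul_lt_top ENNReal.ofReal_lt_top (ENNReal.mul_lt_top ENNReal.ofReal_lt_top hC)
  obtain ⟨hi, hle⟩ := integrable_inv_norm_mul_hyperplaneIntegral hd hr hFc hFd hB fun δ hδ hδ1 => by
    calc ∫⁻ x, ∫⁻ z, ENNReal.ofReal (slabKernel δ x z) * ‖F x z‖ₑ
        ≤ ∫⁻ x, ∫⁻ z, ENNReal.ofReal M *
            (ENNReal.ofReal (slabKernel δ x z) * pairWeight d r s x z) :=
          lintegral_mono fun x => lintegral_mono fun z => hpt δ hδ1 x z
      _ = ENNReal.ofReal M *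
            ∫⁻ x, ∫⁻ z, ENNReal.ofReal (slabKernel δ x z) * pairWeight d r s x z := by
          simp only [lintegral_const_mul' _ _ ENNReal.ofReal_ne_top]
      _ ≤ _ := by
          gcongr
          exact hCb s δ hδ
  refine ⟨hi, ?_⟩
  have h := ENNReal.toReal_mono hB.ne hle
  rw [toReal_enorm, Real.norm_eq_abs, ENNReal.toReal_mul, ENNReal.toReal_mul,
    ENNReal.toReal_ofReal hM0, ENNReal.toReal_ofReal (by positivity)] at h
  refine h.trans_eq ?_
  rw [hM, neg_add, Real.rpow_add (by positivity), Real.rpow_neg_one]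
  ring

lemma abs_le_wNorm_mul {d : ℕ} {r : ℝ} {y : Rd d → ℝ}
    (hy : ∃ K : ℝ, ∀ s : Rd d, (1 + ‖s‖) ^ r * |y s| ≤ K) (u : Rd d) :
    |y u| ≤ wNorm d r y * (1 + ‖u‖) ^ (-r) := by
  obtain ⟨K, hK⟩ := hy
  have hb : BddAbove (range fun s : Rd d => (1 + ‖s‖) ^ r * |y s|) :=
    ⟨K, by rintro _ ⟨s, rfl⟩; exact hK s⟩
  have h := le_ciSup hb u
  rw [Real.rpow_neg (by positivity), ← div_eq_mul_inv, le_div_iff₀ (by positivity), mul_comm]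
  exact h

/-- For `d ≥ 2` and `r > d` there is `C > 0` such that for every `R > 0`
and all `y, y' ∈ C_r(ℝ^d)` with `‖y‖_r ≤ R`, `‖y'‖_r ≤ R`, one has
`‖K(y) − K(y')‖_{r+1} ≤ C R² ‖y − y'‖_r`. -/
theorem statement6 (d : ℕ) (hd : 2 ≤ d) (r : ℝ) (hr : (d : ℝ) < r) :
    ∃ C : ℝ, 0 < C ∧ ∀ R : ℝ, 0 < R → ∀ y y' : Rd d → ℝ,
      memCr d r y → memCr d r y' → wNorm d r y ≤ R → wNorm d r y' ≤ R →
      wNorm d (r + 1) (fun s => Kwk d y s - Kwk d y' s)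
        ≤ C * R ^ 2 * wNorm d r (fun s => y s - y' s) := by
  have hr0 : 0 ≤ r := (Nat.cast_nonneg d).trans hr.le
  obtain ⟨C, hC, hmain⟩ := exists_kinIntegrand_sub_bound hd hr
  refine ⟨2 * Real.pi * C + 1, by positivity, fun R hR y y' hy hy' hyR hyR' => ?_⟩
  have hdiff : ∃ K : ℝ, ∀ s : Rd d, (1 + ‖s‖) ^ r * |y s - y' s| ≤ K := by
    obtain ⟨K, hK⟩ := hy.2
    obtain ⟨K', hK'⟩ := hy'.2
    refine ⟨K + K', fun s => ?_⟩
    calc (1 + ‖s‖) ^ r * |y s - y' s| ≤ (1 + ‖s‖) ^ r * (|y s| + |y' s|) := by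
          gcongr
          exact abs_sub _ _
      _ ≤ K + K' := by
          rw [mul_add]
          exact add_le_add (hK s) (hK' s)
  have bound {f : Rd d → ℝ} (hf : memCr d r f) (hfR : wNorm d r f ≤ R) (u : Rd d) :
      |f u| ≤ R * (1 + ‖u‖) ^ (-r) := (abs_le_wNorm_mul hf.2 u).trans (by gcongr)
  have hint {f : Rd d → ℝ} (hf : memCr d r f) (hfR : wNorm d r f ≤ R) (s : Rd d) :
      Integrable fun x => ‖x‖⁻¹ * hyperplaneIntegral d x (kinIntegrand d f s x) := by
    have h := (hmain R R f (fun _ => 0) hf.1 continuous_const (bound hf hfR)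
      (fun u => by simp; positivity) (fun u => by simpa using bound hf hfR u) s).1
    have h0 (x z : Rd d) : kinIntegrand d (fun _ => 0) s x z = 0 := by simp [kinIntegrand]
    simpa only [h0, sub_zero] using h
  have hN := abs_le_wNorm_mul hdiff
  have hN0 : 0 ≤ wNorm d r (fun s => y s - y' s) := by simpa using (abs_nonneg _).trans (hN 0)
  refine ciSup_le fun s => ?_
  have hK : Kwk d y s - Kwk d y' s = 2 * Real.pi * ∫ x, ‖x‖⁻¹ *
      hyperplaneIntegral d x (fun z => kinIntegrand d y s x z - kinIntegrand d y' s x z) := by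
    rw [Kwk, Kwk, ← mul_sub, ← integral_sub (hint hy hyR s) (hint hy' hyR' s)]
    congr 2 with x
    rw [hyperplaneIntegral_sub hr x ((continuous_kinIntegrand_s6 hy.1 s).uncurry_left x)
      ((continuous_kinIntegrand_s6 hy'.1 s).uncurry_left x)
      (exists_abs_kinIntegrand_le hr0 (bound hy hyR) s x)
      (exists_abs_kinIntegrand_le hr0 (bound hy' hyR') s x), mul_sub]
  have h := (hmain R _ y y' hy.1 hy'.1 (bound hy hyR) (bound hy' hyR') hN s).2
  calc (1 + ‖s‖) ^ (r + 1) * |Kwk d y s - Kwk d y' s|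
      ≤ (1 + ‖s‖) ^ (r + 1) * (2 * Real.pi *
          (C * R ^ 2 * wNorm d r (fun s => y s - y' s) * (1 + ‖s‖) ^ (-(r + 1)))) := by
        rw [hK, abs_mul, abs_of_pos Real.two_pi_pos]
        gcongr
    _ = 2 * Real.pi * C * R ^ 2 * wNorm d r (fun s => y s - y' s) := by
        rw [Real.rpow_neg (by positivity)]
        field_simp
    _ ≤ (2 * Real.pi * C + 1) * R ^ 2 * wNorm d r (fun s => y s - y' s) := by
        gcongr
        linarith
end
end
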